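/- (Random semiuniform ergodic theorem.) Let Θ(ω,x) = (θω, φ(1,ω,x)) be the skew product of a discrete-time RDS φ over an ergodic θ, let K be a forward invariant random compact set, and let (Φ_n) be a subadditive sequence of random continuous functions with ω ↦ max_{x∈K(ω)}|Φ_n(ω,x)| integrable for every n. Suppose λ ∈ ℝ satisfies λ(μ,φ) < λ for all μ ∈ 𝓜_ℙ(K). Then there exist λ' < λ and an adjusted random variable C : Ω → ℝ such that Φ_n(ω,x) ≤ C(ω) + nλ' for all n ∈ ℕ, ℙ-a.e. ω ∈ Ω and all x ∈ K(ω). In particular, for every δ ∈ (0, λ−λ') and ℙ-a.e. ω there is N(ω) ∈ ℕ such that (1/n)Φ_n(ω,x) ≤ λ − δ for all n ≥ N(ω) and all x ∈ K(ω). -/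

import Mathlib

open MeasureTheory Metric Function Filter

namespace SemiuniformErgodic

section Birkhoff

variable {Ω : Type*} {θ : Ω → Ω}

/-- The running maximum `max_{0 ≤ k ≤ n} S_k F` of the Birkhoff sums, defined recursively. -/
def maxSum (θ : Ω → Ω) (F : Ω → ℝ) : ℕ → Ω → ℝ
  | 0, _ => 0
  | n + 1, ω => max 0 (F ω + maxSum θ F n (θ ω))

lemma maxSum_nonneg (F : Ω → ℝ) (n : ℕ) (ω : Ω) : 0 ≤ maxSum θ F n ω := by
  cases n <;> simp [maxSum]

lemma maxSum_le_succ (F : Ω → ℝ) (n : ℕ) : ∀ ω, maxSum θ F n ω ≤ maxSum θ F (n + 1) ω := by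
  induction n with
  | zero => intro ω; simp [maxSum]
  | succ n ih =>
    intro ω
    rw [maxSum, maxSum]
    gcongr
    exact ih _

lemma birkhoffSum_le_maxSum (F : Ω → ℝ) (n : ℕ) :
    ∀ ω, birkhoffSum θ F n ω ≤ maxSum θ F n ω := by
  induction n with
  | zero => intro ω; simp [maxSum]
  | succ n ih =>
    intro ω
    rw [birkhoffSum_succ', maxSum]
    exact le_max_of_le_right (by gcongr; exact ih _)

lemma birkhoffSum_sub_const (F : Ω → ℝ) (c : ℝ) (n : ℕ) (ω : Ω) :
    birkhoffSum θ (fun ω => F ω - c) n ω = birkhoffSum θ F n ω - n * c := by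
  simp [birkhoffSum, Finset.sum_sub_distrib]

variable [MeasurableSpace Ω] {ℙ : Measure Ω}

lemma measurable_maxSum (hθ : Measurable θ) {F : Ω → ℝ} (hF : Measurable F) (n : ℕ) :
    Measurable (maxSum θ F n) := by
  induction n with
  | zero => exact measurable_const
  | succ n ih => exact measurable_const.max (hF.add (ih.comp hθ))

lemma integrable_maxSum (hθ : MeasurePreserving θ ℙ ℙ) {F : Ω → ℝ}
    (hFi : Integrable F ℙ) (n : ℕ) : Integrable (maxSum θ F n) ℙ := by
  induction n with
  | zero => exact integrable_zero _ _ _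
  | succ n ih =>
    exact (integrable_zero _ _ _).sup (hFi.add (hθ.integrable_comp_of_integrable ih))

/-- If `∫ F < 0` then the Birkhoff sums of `F` are almost surely bounded above. -/
theorem ae_bddAbove_birkhoffSum (hθ : Ergodic θ ℙ) {F : Ω → ℝ} (hF : Measurable F)
    (hFi : Integrable F ℙ) (hneg : ∫ ω, F ω ∂ℙ < 0) :
    ∀ᵐ ω ∂ℙ, BddAbove (Set.range fun n => birkhoffSum θ F n ω) := by
  have hmp := hθ.toMeasurePreserving
  set B : Set Ω := {ω | BddAbove (Set.range fun n => maxSum θ F n ω)} with hB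
  have hBm : MeasurableSet B :=
    measurableSet_bddAbove_range fun n => measurable_maxSum hmp.measurable hF n
  have hinv : θ ⁻¹' B = B := by
    ext ω
    simp only [hB, Set.mem_preimage, Set.mem_ofPred_eq]
    constructor
    · rintro ⟨c, hc⟩
      refine ⟨max 0 (F ω + c), ?_⟩
      rintro _ ⟨n, rfl⟩
      cases n with
      | zero => simp [maxSum]
      | succ n =>
        have := hc ⟨n, rfl⟩
        simp only [maxSum] at this ⊢
        gcongr
    · rintro ⟨c, hc⟩
      refine ⟨c - F ω, ?_⟩
      rintro _ ⟨n, rfl⟩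
      have := hc ⟨n + 1, rfl⟩
      simp only [maxSum, max_le_iff] at this ⊢
      linarith [this.2]
  rcases hθ.toPreErgodic.ae_empty_or_univ hBm hinv with h | h
  · exfalso
    have hunb : ∀ᵐ ω ∂ℙ, ω ∉ B := by
      filter_upwards [h] with ω hω
      intro hmem
      exact (hω.mp hmem : ω ∈ (∅ : Set Ω))
    have hlim : Tendsto (fun n => ∫ ω, max (-maxSum θ F n (θ ω)) (F ω) ∂ℙ) atTop
        (nhds (∫ ω, F ω ∂ℙ)) := by
      refine tendsto_integral_of_dominated_convergence (fun ω => |F ω|) ?_ hFi.abs ?_ ?_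
      · intro n
        exact (((measurable_maxSum hmp.measurable hF n).comp hmp.measurable).neg.max
          hF).aestronglyMeasurable
      · intro n
        refine Eventually.of_forall fun ω => ?_
        rw [Real.norm_eq_abs, abs_le]
        have h0 := maxSum_nonneg (θ := θ) F n (θ ω)
        refine ⟨le_trans (neg_abs_le _) (le_max_right _ _), max_le ?_ (le_abs_self _)⟩
        linarith [abs_nonneg (F ω)]
      · filter_upwards [hunb] with ω hω
        have hω' : θ ω ∉ B := by
          intro hc
          exact hω (by rw [← hinv]; exact hc)
        have hmono : Monotone fun n => maxSum θ F n (θ ω) :=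
          monotone_nat_of_le_succ fun n => maxSum_le_succ F n _
        have htop : Tendsto (fun n => maxSum θ F n (θ ω)) atTop atTop :=
          tendsto_atTop_atTop_of_monotone' hmono hω'
        refine tendsto_const_nhds.congr' ?_
        filter_upwards [htop.eventually_ge_atTop (-F ω)] with n hn
        rw [max_eq_right]
        linarith
    have hnn : ∀ n, 0 ≤ ∫ ω, max (-maxSum θ F n (θ ω)) (F ω) ∂ℙ := by
      intro n
      have hi1 := integrable_maxSum hmp hFi (n + 1)
      have hi0 := integrable_maxSum hmp hFi n
      have hi0' := hmp.integrable_comp_of_integrable hi0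
      have heq : ∀ ω, max (-maxSum θ F n (θ ω)) (F ω)
          = maxSum θ F (n + 1) ω - (maxSum θ F n ∘ θ) ω := by
        intro ω
        simp only [maxSum, Function.comp, ← max_sub_sub_right]
        congr 1 <;> ring
      simp_rw [heq]
      rw [integral_sub hi1 hi0']
      have : ∫ ω, (maxSum θ F n ∘ θ) ω ∂ℙ = ∫ ω, maxSum θ F n ω ∂ℙ := by
        have h2 := integral_map (μ := ℙ) hmp.measurable.aemeasurable
          (f := maxSum θ F n) (measurable_maxSum hmp.measurable hF n).aestronglyMeasurable
        rw [hmp.map_eq] at h2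
        exact h2.symm
      rw [this, sub_nonneg]
      exact integral_mono hi0 hi1 (maxSum_le_succ F n)
    linarith [ge_of_tendsto' hlim hnn]
  · filter_upwards [h] with ω hω
    have hmem : ω ∈ B := hω.mpr trivial
    obtain ⟨c, hc⟩ := hmem
    refine ⟨c, ?_⟩
    rintro _ ⟨n, rfl⟩
    exact (birkhoffSum_le_maxSum F n ω).trans (hc ⟨n, rfl⟩)

lemma ae_eventually_birkhoffSum_le [IsProbabilityMeasure ℙ] (hθ : Ergodic θ ℙ) {F : Ω → ℝ}
    (hF : Measurable F) (hFi : Integrable F ℙ) {c : ℝ} (hc : ∫ ω, F ω ∂ℙ < c) :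
    ∀ᵐ ω ∂ℙ, ∀ᶠ n : ℕ in atTop, birkhoffSum θ F n ω ≤ n * c := by
  obtain ⟨d, hd, hdc⟩ := exists_between hc
  have := ae_bddAbove_birkhoffSum hθ (F := fun ω => F ω - d) (hF.sub_const d)
    (hFi.sub (integrable_const d)) (by
      rw [integral_sub hFi (integrable_const d)]; simp; linarith)
  filter_upwards [this] with ω ⟨b, hb⟩
  have htop : Tendsto (fun n : ℕ => (n : ℝ) * (c - d)) atTop atTop :=
    tendsto_natCast_atTop_atTop.atTop_mul_const (by linarith)
  filter_upwards [htop.eventually_ge_atTop b] with n hn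
  have h1 := hb ⟨n, rfl⟩
  simp only [birkhoffSum_sub_const] at h1
  linarith

/-- Birkhoff's pointwise ergodic theorem for an ergodic transformation. -/
theorem ae_tendsto_birkhoffSum_div [IsProbabilityMeasure ℙ] (hθ : Ergodic θ ℙ) {F : Ω → ℝ}
    (hF : Measurable F) (hFi : Integrable F ℙ) :
    ∀ᵐ ω ∂ℙ, Tendsto (fun n : ℕ => birkhoffSum θ F n ω / n) atTop (nhds (∫ ω, F ω ∂ℙ)) := by
  have hu : ∀ᵐ ω ∂ℙ, ∀ k : ℕ, ∀ᶠ n : ℕ in atTop,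
      birkhoffSum θ F n ω ≤ n * (∫ ω, F ω ∂ℙ + 1 / ((k : ℝ) + 1)) :=
    ae_all_iff.2 fun k => ae_eventually_birkhoffSum_le hθ hF hFi
      (by have : 0 < 1 / ((k : ℝ) + 1) := Nat.one_div_pos_of_nat
          linarith)
  have hl : ∀ᵐ ω ∂ℙ, ∀ k : ℕ, ∀ᶠ n : ℕ in atTop,
      birkhoffSum θ (fun ω => -F ω) n ω ≤ n * (-∫ ω, F ω ∂ℙ + 1 / ((k : ℝ) + 1)) :=
    ae_all_iff.2 fun k => ae_eventually_birkhoffSum_le hθ hF.neg hFi.neg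
      (by have : 0 < 1 / ((k : ℝ) + 1) := Nat.one_div_pos_of_nat
          have h := integral_neg (μ := ℙ) F
          simp only [Pi.neg_apply] at h ⊢
          linarith)
  filter_upwards [hu, hl] with ω hu hl
  rw [Metric.tendsto_nhds]
  intro ε hε
  obtain ⟨k, hk⟩ := exists_nat_one_div_lt hε
  filter_upwards [hu k, hl k, eventually_gt_atTop 0] with n h1 h2 hn
  have hn' : (0 : ℝ) < n := by exact_mod_cast hn
  have h3 : birkhoffSum θ (fun ω => -F ω) n ω = - birkhoffSum θ F n ω := by
    simp [birkhoffSum]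
  rw [h3] at h2
  rw [Real.dist_eq]
  refine lt_of_le_of_lt (abs_le.2 ⟨?_, ?_⟩) hk
  · rw [le_sub_iff_add_le, le_div_iff₀ hn']; linarith
  · rw [sub_le_iff_le_add, div_le_iff₀ hn']; linarith

lemma ae_tendsto_iterate_div [IsProbabilityMeasure ℙ] (hθ : Ergodic θ ℙ) {g : Ω → ℝ}
    (hg : Measurable g) (hgi : Integrable g ℙ) :
    ∀ᵐ ω ∂ℙ, Tendsto (fun n : ℕ => g (θ^[n] ω) / n) atTop (nhds 0) := by
  filter_upwards [ae_tendsto_birkhoffSum_div hθ hg hgi] with ω h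
  have h1 : Tendsto (fun n : ℕ => birkhoffSum θ g (n + 1) ω / ((n + 1 : ℕ) : ℝ)) atTop
      (nhds (∫ ω, g ω ∂ℙ)) := (tendsto_add_atTop_iff_nat 1).2 h
  have h2 : Tendsto (fun n : ℕ => ((n + 1 : ℕ) : ℝ) / n) atTop (nhds 1) := by
    have h0 := (tendsto_const_nhds (x := (1 : ℝ))).add (tendsto_one_div_atTop_nhds_zero_nat (𝕜 := ℝ))
    rw [add_zero] at h0
    refine h0.congr' ?_
    filter_upwards [eventually_gt_atTop 0] with n hn
    have hn' : (n : ℝ) ≠ 0 := by positivity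
    push_cast
    field_simp
  have h3 := (h1.mul h2).sub h
  rw [mul_one, sub_self] at h3
  refine h3.congr' ?_
  filter_upwards [eventually_gt_atTop 0] with n hn
  have hn' : (n : ℝ) ≠ 0 := by positivity
  have hn1 : ((n + 1 : ℕ) : ℝ) ≠ 0 := by positivity
  rw [birkhoffSum_succ]
  field_simp
  ring

lemma bddAbove_range_sub_of_tendsto_div {s t : ℕ → ℝ} {c : ℝ} (hc : c < 0)
    (ht : Tendsto (fun n : ℕ => t n / n) atTop (nhds c)) (n : ℕ) :
    BddAbove (Set.range fun k => max 0 (t (n + k) - s n)) := by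
  have h1 : ∀ᶠ k : ℕ in atTop, t k ≤ 0 := by
    filter_upwards [ht.eventually_lt_const hc, eventually_gt_atTop 0] with k hk hk0
    have hk' : (0 : ℝ) < k := by exact_mod_cast hk0
    rw [div_lt_iff₀ hk'] at hk
    linarith
  obtain ⟨b, hb⟩ := (isBoundedUnder_of_eventually_le h1).bddAbove_range
  refine ⟨max 0 (b - s n), ?_⟩
  rintro _ ⟨k, rfl⟩
  have := hb ⟨n + k, rfl⟩
  simp only at this ⊢
  gcongr

lemma tendsto_iSup_sub_div {s t : ℕ → ℝ} {c : ℝ} (hc : c < 0)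
    (hs : Tendsto (fun n : ℕ => s n / n) atTop (nhds c))
    (ht : Tendsto (fun n : ℕ => t n / n) atTop (nhds c)) :
    Tendsto (fun n : ℕ => (⨆ k, max 0 (t (n + k) - s n)) / n) atTop (nhds 0) := by
  rw [Metric.tendsto_nhds]
  intro ε hε
  set η := min (ε / 4) (-c) with hη
  have hη0 : 0 < η := lt_min (by linarith) (by linarith)
  have hηε : η ≤ ε / 4 := min_le_left _ _
  have hηc : η ≤ -c := min_le_right _ _
  have h1 := hs.eventually_const_lt (show c - η < c by linarith)
  have h2 := ht.eventually_lt_const (show c < c + η by linarith)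
  filter_upwards [h1, eventually_forall_ge_atTop.2 h2, eventually_gt_atTop 0] with n h1 h2 hn
  have hn' : (0 : ℝ) < n := by exact_mod_cast hn
  rw [lt_div_iff₀ hn'] at h1
  have hle : ⨆ k, max 0 (t (n + k) - s n) ≤ 2 * η * n := by
    refine ciSup_le fun k => max_le (by positivity) ?_
    have h3 := h2 (n + k) (Nat.le_add_right _ _)
    rw [div_lt_iff₀ (by positivity)] at h3
    push_cast at h3
    have : (c + η) * k ≤ 0 := mul_nonpos_of_nonpos_of_nonneg (by linarith) (Nat.cast_nonneg k)
    nlinarith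
  have hge : 0 ≤ ⨆ k, max 0 (t (n + k) - s n) := Real.iSup_nonneg fun k => le_max_left _ _
  rw [Real.dist_eq, sub_zero, abs_of_nonneg (by positivity), div_lt_iff₀ hn']
  nlinarith

/-- The excess `sup_k (S_k F + g ∘ θ^k)⁺` of a Birkhoff sum with negative drift, perturbed by
an integrable stationary sequence, is almost surely finite and sublinear along orbits. -/
theorem ae_birkhoffSum_add_sublinear [IsProbabilityMeasure ℙ] (hθ : Ergodic θ ℙ) {F g : Ω → ℝ}
    (hF : Measurable F) (hFi : Integrable F ℙ) (hneg : ∫ ω, F ω ∂ℙ < 0)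
    (hg : Measurable g) (hgi : Integrable g ℙ) :
    ∃ D : Ω → ℝ, Measurable D ∧ (∀ ω, 0 ≤ D ω) ∧
      (∀ᵐ ω ∂ℙ, Tendsto (fun n : ℕ => D (θ^[n] ω) / n) atTop (nhds 0)) ∧
      ∀ᵐ ω ∂ℙ, ∀ k : ℕ, birkhoffSum θ F k ω + g (θ^[k] ω) ≤ D ω := by
  have hθm := hθ.toMeasurePreserving.measurable
  have hlim : ∀ᵐ ω ∂ℙ, Tendsto (fun n : ℕ => (birkhoffSum θ F n ω + g (θ^[n] ω)) / n) atTop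
      (nhds (∫ ω, F ω ∂ℙ)) := by
    filter_upwards [ae_tendsto_birkhoffSum_div hθ hF hFi, ae_tendsto_iterate_div hθ hg hgi]
      with ω h1 h2
    simpa [add_div] using h1.add h2
  have hkey : ∀ ω n k, birkhoffSum θ F (n + k) ω + g (θ^[n + k] ω) - birkhoffSum θ F n ω
      = birkhoffSum θ F k (θ^[n] ω) + g (θ^[k] (θ^[n] ω)) := by
    intro ω n k
    rw [birkhoffSum_add, add_comm n k, iterate_add_apply]
    ring
  refine ⟨fun ω => ⨆ k, max 0 (birkhoffSum θ F k ω + g (θ^[k] ω)), ?_, ?_, ?_, ?_⟩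
  · refine Measurable.iSup fun k => measurable_const.max (Measurable.add ?_ ?_)
    · exact Finset.measurable_fun_sum _ fun i _ => hF.comp (hθm.iterate i)
    · exact hg.comp (hθm.iterate k)
  · exact fun ω => Real.iSup_nonneg fun k => le_max_left _ _
  · filter_upwards [hlim, ae_tendsto_birkhoffSum_div hθ hF hFi] with ω ht hs
    have := tendsto_iSup_sub_div hneg hs ht
    simpa only [hkey] using this
  · filter_upwards [hlim] with ω ht k
    have := bddAbove_range_sub_of_tendsto_div (s := fun n => birkhoffSum θ F n ω) hneg ht 0
    have h2 := le_ciSup this k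
    simp only [hkey, iterate_zero, id] at h2
    exact (le_max_right _ _).trans h2

end Birkhoff

section RandomSets

/-- Functions `Ω × X → ℝ` that are measurable in `ω` and continuous in `x`. -/
structure IsCaratheodory {Ω X : Type*} [MeasurableSpace Ω] [TopologicalSpace X]
    (f : Ω → X → ℝ) : Prop where
  measurable : ∀ x, Measurable fun ω => f ω x
  continuous : ∀ ω, Continuous (f ω)

/-- Random nonempty compact sets. -/
structure IsRandomCompact {Ω X : Type*} [MeasurableSpace Ω] [MetricSpace X]
    (K : Ω → Set X) : Prop where
  isCompact : ∀ ω, IsCompact (K ω)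
  nonempty : ∀ ω, (K ω).Nonempty
  measurable_infDist : ∀ x, Measurable fun ω => infDist x (K ω)

variable {Ω X : Type*} [MeasurableSpace Ω] [MetricSpace X]
  {K : Ω → Set X} {f g P : Ω → X → ℝ}

lemma IsCaratheodory.measurable_uncurry [SecondCountableTopology X] [MeasurableSpace X] [BorelSpace X]
    (hf : IsCaratheodory f) : Measurable fun p : Ω × X => f p.1 p.2 := by
  have := measurable_uncurry_of_continuous_of_measurable (u := fun x ω => f ω x)
    hf.continuous hf.measurable
  exact this.comp measurable_swap

lemma IsRandomCompact.measurableSet_graph [SecondCountableTopology X] [MeasurableSpace X]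
    [BorelSpace X] (hK : IsRandomCompact K) : MeasurableSet {p : Ω × X | p.2 ∈ K p.1} := by
  have h : IsCaratheodory fun ω x => infDist x (K ω) :=
    ⟨hK.measurable_infDist, fun ω => continuous_infDist_pt _⟩
  have h2 : {p : Ω × X | p.2 ∈ K p.1} = {p | infDist p.2 (K p.1) = 0} := by
    ext p
    exact (hK.isCompact p.1).isClosed.mem_iff_infDist_zero (hK.nonempty p.1)
  rw [h2]
  exact h.measurable_uncurry (measurableSet_singleton 0)

lemma IsRandomCompact.measurable_sInf_image [SecondCountableTopology X]
    (hK : IsRandomCompact K) (hf : IsCaratheodory f) :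
    Measurable fun ω => sInf (f ω '' K ω) := by
  rcases isEmpty_or_nonempty X with hX | hX
  · have : IsEmpty Ω := ⟨fun ω => (hK.nonempty ω).elim fun x _ => hX.elim x⟩
    exact measurable_of_empty _
  set d := TopologicalSpace.denseSeq X
  have hd : DenseRange d := TopologicalSpace.denseRange_denseSeq X
  refine measurable_of_Iio fun c => ?_
  have hset : (fun ω => sInf (f ω '' K ω)) ⁻¹' Set.Iio c =
      ⋃ (i : ℕ) (r : ℚ) (q : ℚ) (_ : (q : ℝ) < c), ({ω | infDist (d i) (K ω) < r} ∩
        ⋂ (j : ℕ) (_ : dist (d j) (d i) < r), {ω | f ω (d j) ≤ q}) := by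
    ext ω
    have hbdd : BddBelow (f ω '' K ω) :=
      ((hK.isCompact ω).image (hf.continuous ω)).bddBelow
    simp only [Set.mem_preimage, Set.mem_Iio, Set.mem_iUnion, Set.mem_inter_iff,
      Set.mem_iInter, Set.mem_ofPred_eq, exists_prop,
      csInf_lt_iff hbdd ((hK.nonempty ω).image _), Set.exists_mem_image,
      infDist_lt_iff (hK.nonempty ω)]
    constructor
    · rintro ⟨x, hx, hxc⟩
      obtain ⟨q, hq1, hq2⟩ := exists_rat_btwn hxc
      have hopen : IsOpen {y | f ω y < q} := isOpen_lt (hf.continuous ω) continuous_const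
      obtain ⟨ε, hε, hball⟩ := Metric.isOpen_iff.1 hopen x hq1
      obtain ⟨r, hr0, hr⟩ := exists_rat_btwn (half_pos hε)
      obtain ⟨i, hi⟩ := hd.exists_dist_lt x (show (0 : ℝ) < r from hr0)
      refine ⟨i, r, q, hq2, ⟨x, hx, by rwa [dist_comm]⟩, fun j hj => le_of_lt (hball ?_)⟩
      rw [Metric.mem_ball]
      have := dist_triangle_right (d j) x (d i)
      linarith
    · rintro ⟨i, r, q, hqc, ⟨x, hx, hxr⟩, hall⟩
      refine ⟨x, hx, lt_of_le_of_lt ?_ hqc⟩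
      by_contra! hlt
      have hopen : IsOpen ({y | (q : ℝ) < f ω y} ∩ ball (d i) r) :=
        (isOpen_lt continuous_const (hf.continuous ω)).inter isOpen_ball
      obtain ⟨j, hj1, hj2⟩ := hd.exists_mem_open hopen ⟨x, hlt, by rwa [mem_ball, dist_comm]⟩
      exact absurd (hall j hj2) (not_le.2 hj1)
  rw [hset]
  refine MeasurableSet.iUnion fun i => MeasurableSet.iUnion fun r => MeasurableSet.iUnion fun q =>
    MeasurableSet.iUnion fun _ => MeasurableSet.inter ?_ ?_
  · exact measurableSet_lt (hK.measurable_infDist _) measurable_const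
  · exact MeasurableSet.iInter fun j => MeasurableSet.iInter fun _ =>
      measurableSet_le (hf.measurable _) measurable_const

lemma IsCaratheodory.neg (hf : IsCaratheodory f) : IsCaratheodory fun ω x => -f ω x :=
  ⟨fun x => (hf.measurable x).neg, fun ω => (hf.continuous ω).neg⟩

lemma IsCaratheodory.abs (hf : IsCaratheodory f) : IsCaratheodory fun ω x => |f ω x| :=
  ⟨fun x => (hf.measurable x).abs, fun ω => (hf.continuous ω).abs⟩

lemma IsRandomCompact.measurable_sSup_image [SecondCountableTopology X]
    (hK : IsRandomCompact K) (hf : IsCaratheodory f) :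
    Measurable fun ω => sSup (f ω '' K ω) := by
  have h := (hK.measurable_sInf_image hf.neg).neg
  convert h using 2 with ω
  rw [Pi.neg_apply, ← neg_eq_iff_eq_neg, ← Real.sInf_neg, ← Set.image_neg_eq_neg, Set.image_image]

lemma iSup_sInf_image_add_mul {S : Set X} (hS : IsCompact S) {g P : X → ℝ}
    (hg : Continuous g) (hP : Continuous P) (hP0 : ∀ x, 0 ≤ P x) {z : X} (hz : z ∈ S)
    (hPz : P z = 0) (hmin : ∀ x ∈ S, P x = 0 → g z ≤ g x) :
    ⨆ n : ℕ, sInf ((fun x => g x + n * P x) '' S) = g z := by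
  have hc : ∀ n : ℕ, Continuous fun x => g x + n * P x := fun n => by fun_prop
  have hle : ∀ n : ℕ, sInf ((fun x => g x + n * P x) '' S) ≤ g z := fun n =>
    (csInf_le (hS.image (hc n)).bddBelow ⟨z, hz, rfl⟩).trans (by simp [hPz])
  refine le_antisymm (ciSup_le hle) (le_of_forall_lt fun b hb => ?_)
  obtain ⟨b', hbb', hb'⟩ := exists_between hb
  obtain ⟨n, hn⟩ := hS.elim_directed_cover (fun n : ℕ => {x | b' < g x + n * P x})
    (fun n => isOpen_lt continuous_const (hc n))
    (fun x hx => by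
      rw [Set.mem_iUnion]
      rcases (hP0 x).eq_or_lt with h | h
      · exact ⟨0, by simpa using hb'.trans_le (hmin x hx h.symm)⟩
      · obtain ⟨n, hn⟩ := exists_nat_gt ((b' - g x) / P x)
        rw [div_lt_iff₀ h] at hn
        exact ⟨n, by simp only [Set.mem_ofPred_eq]; linarith⟩)
    (Monotone.directed_le fun m n hmn x hx => by
      simp only [Set.mem_ofPred_eq] at hx ⊢
      have : (m : ℝ) * P x ≤ n * P x :=
        mul_le_mul_of_nonneg_right (by exact_mod_cast hmn) (hP0 x)
      linarith)
  refine hbb'.trans_le (le_trans ?_ (le_ciSup ⟨g z, by rintro _ ⟨m, rfl⟩; exact hle m⟩ n))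
  refine le_csInf ⟨_, ⟨z, hz, rfl⟩⟩ ?_
  rintro _ ⟨x, hx, rfl⟩
  exact (hn hx).le

/-- Nonnegative random continuous functions having a zero in every `K ω`. -/
structure IsPenalty (K : Ω → Set X) (P : Ω → X → ℝ) : Prop extends IsCaratheodory P where
  nonneg : ∀ ω x, 0 ≤ P ω x
  exists_zero : ∀ ω, ∃ x ∈ K ω, P ω x = 0

lemma IsPenalty.exists_refine [SecondCountableTopology X] (hK : IsRandomCompact K) (hP : IsPenalty K P)
    (hg : IsCaratheodory g) :
    ∃ P' : Ω → X → ℝ, IsPenalty K P' ∧ ∃ v : Ω → ℝ, Measurable v ∧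
      (∀ ω, ∀ x ∈ K ω, P ω x = 0 → v ω ≤ g ω x) ∧
      ∀ ω x, P' ω x = 0 → P ω x = 0 ∧ g ω x = v ω := by
  set v : Ω → ℝ := fun ω => ⨆ n : ℕ, sInf ((fun x => g ω x + n * P ω x) '' K ω) with hv
  have hvm : Measurable v := Measurable.iSup fun n => hK.measurable_sInf_image
    ⟨fun x => (hg.measurable x).add ((hP.measurable x).const_mul _),
      fun ω => (hg.continuous ω).add ((hP.continuous ω).const_mul _)⟩
  have hmin : ∀ ω, ∃ z ∈ K ω, P ω z = 0 ∧ (∀ x ∈ K ω, P ω x = 0 → g ω z ≤ g ω x) := by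
    intro ω
    have hc : IsCompact (K ω ∩ {x | P ω x = 0}) :=
      (hK.isCompact ω).inter_right (isClosed_eq (hP.continuous ω) continuous_const)
    obtain ⟨x, hx, hx0⟩ := hP.exists_zero ω
    obtain ⟨z, hz, hzmin⟩ := hc.exists_isMinOn ⟨x, hx, hx0⟩ (hg.continuous ω).continuousOn
    exact ⟨z, hz.1, hz.2, fun y hy hy0 => hzmin ⟨hy, hy0⟩⟩
  choose z hzK hz0 hzmin using hmin
  have hvz : ∀ ω, v ω = g ω (z ω) := fun ω =>
    iSup_sInf_image_add_mul (hK.isCompact ω) (hg.continuous ω) (hP.continuous ω) (hP.nonneg ω)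
      (hzK ω) (hz0 ω) (hzmin ω)
  refine ⟨fun ω x => P ω x + |g ω x - v ω|, ⟨⟨fun x => ?_, fun ω => ?_⟩, fun ω x => ?_,
    fun ω => ⟨z ω, hzK ω, ?_⟩⟩, v, hvm, fun ω x hx hx0 => ?_, fun ω x hx => ?_⟩
  · exact (hP.measurable x).add ((hg.measurable x).sub hvm).abs
  · exact (hP.continuous ω).add ((hg.continuous ω).sub continuous_const).abs
  · exact add_nonneg (hP.nonneg ω x) (abs_nonneg _)
  · simp [hz0, hvz]
  · rw [hvz]; exact hzmin ω x hx hx0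
  · have h1 := hP.nonneg ω x
    have h2 := abs_nonneg (g ω x - v ω)
    refine ⟨by linarith, ?_⟩
    have h3 : |g ω x - v ω| = 0 := by linarith
    exact sub_eq_zero.1 (abs_eq_zero.1 h3)

/-- A random continuous function on a random compact set has a measurable maximizer. -/
theorem IsRandomCompact.exists_measurable_isMaxOn [PolishSpace X] [MeasurableSpace X]
    [BorelSpace X] (hK : IsRandomCompact K) (hf : IsCaratheodory f) :
    ∃ y : Ω → X, Measurable y ∧ (∀ ω, y ω ∈ K ω) ∧ ∀ ω, ∀ x ∈ K ω, f ω x ≤ f ω (y ω) := by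
  rcases isEmpty_or_nonempty X with hX | hX
  · have : IsEmpty Ω := ⟨fun ω => (hK.nonempty ω).elim fun x _ => hX.elim x⟩
    exact ⟨fun ω => isEmptyElim ω, measurable_of_empty _, fun ω => isEmptyElim ω,
      fun ω => isEmptyElim ω⟩
  set d := TopologicalSpace.denseSeq X
  have hd : DenseRange d := TopologicalSpace.denseRange_denseSeq X
  set G : ℕ → Ω → X → ℝ := fun n => Nat.casesOn n (fun ω x => -f ω x) fun i _ x => dist x (d i)
    with hG
  have hGc : ∀ n, IsCaratheodory (G n) := by
    rintro (_ | i)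
    · exact hf.neg
    · exact ⟨fun x => measurable_const, fun ω => continuous_id.dist continuous_const⟩
  choose next hnext v hvm hvle hnext0 using
    fun (n : ℕ) (P : {P : Ω → X → ℝ // IsPenalty K P}) => P.2.exists_refine hK (hGc n)
  let p0 : {P : Ω → X → ℝ // IsPenalty K P} :=
    ⟨fun _ _ => 0, ⟨⟨fun _ => measurable_const, fun _ => continuous_const⟩, fun _ _ => le_rfl,
      fun ω => (hK.nonempty ω).imp fun x hx => ⟨hx, rfl⟩⟩⟩
  let p : ℕ → {P : Ω → X → ℝ // IsPenalty K P} :=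
    fun n => Nat.rec p0 (fun n P => ⟨next n P, hnext n P⟩) n
  have hp0 : ∀ ω x, (p 0).1 ω x = 0 := fun _ _ => rfl
  have hps : ∀ n ω x, (p (n + 1)).1 ω x = 0 → (p n).1 ω x = 0 ∧ G n ω x = v n (p n) ω :=
    fun n => hnext0 n (p n)
  have hy : ∀ ω, (⋂ n, K ω ∩ {x | (p n).1 ω x = 0}).Nonempty := by
    intro ω
    have hcl : ∀ n, IsClosed {x | (p n).1 ω x = 0} := fun n =>
      isClosed_eq ((p n).2.continuous ω) continuous_const
    refine IsCompact.nonempty_iInter_of_sequence_nonempty_isCompact_isClosed _ ?_ ?_ ?_ ?_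
    · exact fun n x hx => ⟨hx.1, (hps n ω x hx.2).1⟩
    · exact fun n => (p n).2.exists_zero ω
    · exact (hK.isCompact ω).inter_right (hcl 0)
    · exact fun n => (hK.isCompact ω).isClosed.inter (hcl n)
  choose y hy using hy
  have hyK : ∀ ω, y ω ∈ K ω := fun ω => (Set.mem_iInter.1 (hy ω) 0).1
  have hyv : ∀ n ω, G n ω (y ω) = v n (p n) ω := fun n ω =>
    (hps n ω _ (Set.mem_iInter.1 (hy ω) (n + 1)).2).2
  refine ⟨y, ?_, hyK, fun ω x hx => ?_⟩
  · set ι : X → ℕ → ℝ := fun x i => dist x (d i)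
    have hιc : Continuous ι := continuous_pi fun i => continuous_id.dist continuous_const
    have hιi : Injective ι := by
      intro x x' h
      by_contra hne
      obtain ⟨i, hi⟩ := hd.exists_dist_lt x (half_pos (dist_pos.2 hne))
      have h1 : dist x (d i) = dist x' (d i) := congrFun h i
      have := dist_triangle_right x x' (d i)
      linarith
    rw [← (hιc.measurableEmbedding hιi).measurable_comp_iff]
    refine measurable_pi_iff.2 fun i => ?_
    have : (fun ω => (ι ∘ y) ω i) = v (i + 1) (p (i + 1)) := by
      ext ω
      exact hyv (i + 1) ω
    rw [this]
    exact hvm _ _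
  · have h1 := hvle 0 (p 0) ω x hx (hp0 ω x)
    rw [← hyv] at h1
    exact neg_le_neg_iff.1 h1

end RandomSets

section Compactness

/-- A countable family of bounded continuous functions separating probability measures. -/
lemma exists_separating_seq (X : Type*) [MetricSpace X] [SecondCountableTopology X]
    [MeasurableSpace X] [BorelSpace X] :
    ∃ g : ℕ → BoundedContinuousFunction X ℝ, (∀ j x, ‖g j x‖ ≤ 1) ∧
      ∀ p q : ProbabilityMeasure X,
        (∀ j, ∫ x, g j x ∂(p : Measure X) = ∫ x, g j x ∂(q : Measure X)) → p = q := by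
  set B := TopologicalSpace.countableBasis X
  let F : Finset B → Set X := fun s => ⋂ U ∈ s, ((U : Set X))ᶜ
  have hF : ∀ s, IsClosed (F s) := fun s => isClosed_biInter fun U _ =>
    (TopologicalSpace.isOpen_of_mem_countableBasis U.2).isClosed_compl
  have hδ : ∀ m : ℕ, 0 < 1 / ((m : ℝ) + 1) := fun m => Nat.one_div_pos_of_nat
  let f : Finset B × ℕ → BoundedContinuousFunction X ℝ := fun i =>
    BoundedContinuousFunction.ofNormedAddCommGroup
      (fun x => ((thickenedIndicator (hδ i.2) (F i.1) x : NNReal) : ℝ))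
      (NNReal.continuous_coe.comp (thickenedIndicator (hδ i.2) (F i.1)).continuous) 1
      (fun x => by
        rw [Real.norm_eq_abs, abs_of_nonneg (NNReal.coe_nonneg _)]
        exact_mod_cast thickenedIndicator_le_one (hδ i.2) (F i.1) x)
  have : Countable B := (TopologicalSpace.countable_countableBasis X).to_subtype
  obtain ⟨e, he⟩ := exists_surjective_nat (Finset B × ℕ)
  refine ⟨fun j => f (e j), fun j x => ?_, fun p q h => ?_⟩
  · simp only [f, BoundedContinuousFunction.coe_ofNormedAddCommGroup]
    rw [Real.norm_eq_abs, abs_of_nonneg (NNReal.coe_nonneg _)]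
    exact_mod_cast thickenedIndicator_le_one (hδ _) _ x
  have hint : ∀ i, ∫ x, f i x ∂(p : Measure X) = ∫ x, f i x ∂(q : Measure X) := fun i => by
    obtain ⟨j, rfl⟩ := he i
    exact h j
  have hlint : ∀ (r : ProbabilityMeasure X) s m,
      ∫⁻ x, (thickenedIndicator (hδ m) (F s) x : ENNReal) ∂(r : Measure X) =
        ENNReal.ofReal (∫ x, f (s, m) x ∂(r : Measure X)) := by
    intro r s m
    rw [ofReal_integral_eq_lintegral_ofReal ((f (s, m)).integrable _)
      (Eventually.of_forall fun x => NNReal.coe_nonneg _)]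
    refine lintegral_congr fun x => ?_
    simp [f]
  have hmeas : ∀ s, (p : Measure X) (F s) = (q : Measure X) (F s) := by
    intro s
    have hp := tendsto_lintegral_thickenedIndicator_of_isClosed (p : Measure X) (hF s) hδ
      tendsto_one_div_add_atTop_nhds_zero_nat
    have hq := tendsto_lintegral_thickenedIndicator_of_isClosed (q : Measure X) (hF s) hδ
      tendsto_one_div_add_atTop_nhds_zero_nat
    simp only [hlint, hint] at hp hq
    exact tendsto_nhds_unique hp hq
  suffices hpq : (p : Measure X) = (q : Measure X) from Subtype.ext hpq
  refine ext_of_generate_finite (Set.range F) ?_ ?_ ?_ ?_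
  · rw [BorelSpace.measurable_eq (α := X)]
    refine le_antisymm ?_ (MeasurableSpace.generateFrom_le ?_)
    · rw [(TopologicalSpace.isBasis_countableBasis X).borel_eq_generateFrom]
      refine MeasurableSpace.generateFrom_le fun U hU => ?_
      refine @MeasurableSet.of_compl X _ (MeasurableSpace.generateFrom (Set.range F)) ?_
      refine MeasurableSpace.measurableSet_generateFrom ⟨{⟨U, hU⟩}, ?_⟩
      ext x
      simp only [F, Set.mem_iInter, Finset.mem_singleton, forall_eq]
    · rintro _ ⟨s, rfl⟩
      rw [← BorelSpace.measurable_eq (α := X)]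
      exact (hF s).measurableSet
  · classical
    rintro _ ⟨s, rfl⟩ _ ⟨t, rfl⟩ -
    refine ⟨s ∪ t, ?_⟩
    ext x
    simp only [F, Set.mem_iInter, Set.mem_inter_iff, Finset.mem_union, or_imp, forall_and]
  · rintro _ ⟨s, rfl⟩
    exact hmeas s
  · simp

/-- Probability measures on a compact set converge weakly as soon as their integrals against
a separating family converge. -/
lemma exists_tendsto_of_separating {X : Type*} [MetricSpace X] [MeasurableSpace X] [BorelSpace X]
    {g : ℕ → BoundedContinuousFunction X ℝ}
    (hg : ∀ p q : ProbabilityMeasure X,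
      (∀ j, ∫ x, g j x ∂(p : Measure X) = ∫ x, g j x ∂(q : Measure X)) → p = q)
    {S : Set X} (hS : IsCompact S) {p : ℕ → ProbabilityMeasure X}
    (hp : ∀ n, (p n : Measure X) Sᶜ = 0)
    (hlim : ∀ j, ∃ l, Tendsto (fun n => ∫ x, g j x ∂(p n : Measure X)) atTop (nhds l)) :
    ∃ q : ProbabilityMeasure X, Tendsto p atTop (nhds q) ∧ (q : Measure X) Sᶜ = 0 := by
  have hT : IsCompact {q : ProbabilityMeasure X | ∀ _ : ℕ, q Sᶜ ≤ (0 : NNReal)} :=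
    isCompact_setOfPred_probabilityMeasure_mass_eq_compl_isCompact_le (u := fun _ => 0)
      tendsto_const_nhds (fun _ => hS) (Or.inl inferInstance)
  have hpT : ∀ n, p n ∈ {q : ProbabilityMeasure X | ∀ _ : ℕ, q Sᶜ ≤ (0 : NNReal)} := by
    intro n _
    rw [ProbabilityMeasure.coeFn_def]
    simp [hp n]
  have hclu : ∀ (q : ProbabilityMeasure X) (j : ℕ) (l : ℝ), MapClusterPt q atTop p →
      Tendsto (fun n => ∫ x, g j x ∂(p n : Measure X)) atTop (nhds l) →
      ∫ x, g j x ∂(q : Measure X) = l := by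
    intro q j l hq hl
    have hcont : ContinuousAt (fun r : ProbabilityMeasure X => ∫ x, g j x ∂(r : Measure X)) q :=
      (ProbabilityMeasure.tendsto_iff_forall_integral_tendsto.1 tendsto_id) (g j)
    have h1 := hq.continuousAt_comp hcont
    have h2 : ClusterPt _ (nhds l) := ClusterPt.mono h1 hl
    exact eq_of_nhds_neBot h2
  obtain ⟨q, hqT, hq⟩ := hT.exists_mapClusterPt (f := atTop) (u := p)
    (tendsto_principal.2 (Eventually.of_forall hpT))
  refine ⟨q, hT.tendsto_nhds_of_unique_mapClusterPt (Eventually.of_forall hpT) ?_, ?_⟩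
  · intro r _ hr
    refine hg r q fun j => ?_
    obtain ⟨l, hl⟩ := hlim j
    rw [hclu r j l hr hl, hclu q j l hq hl]
  · have := hqT 0
    rw [ProbabilityMeasure.coeFn_def] at this
    simpa [ENNReal.toNNReal_eq_zero_iff] using this

/-- In a Hilbert space, a decreasing sequence of nonempty midpoint-closed sets has a Cauchy
sequence of selections. -/
lemma exists_cauchySeq_of_midpoint {α H : Type*} [NormedAddCommGroup H] [InnerProductSpace ℝ H]
    {S : ℕ → Set α} (hS : Antitone S) (hne : ∀ n, (S n).Nonempty) {V : α → H} {R : ℝ}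
    (hR : ∀ a, ‖V a‖ ≤ R)
    (hmid : ∀ n, ∀ a ∈ S n, ∀ b ∈ S n, ∃ c ∈ S n, V c = (1 / 2 : ℝ) • (V a + V b)) :
    ∃ a : ℕ → α, (∀ n, a n ∈ S n) ∧ CauchySeq fun n => V (a n) := by
  set d : ℕ → ℝ := fun n => sInf ((fun a => ‖V a‖ ^ 2) '' S n) with hd
  have hbelow : ∀ n, BddBelow ((fun a => ‖V a‖ ^ 2) '' S n) := fun n =>
    ⟨0, by rintro _ ⟨a, _, rfl⟩; positivity⟩
  have hdle : ∀ n, ∀ a ∈ S n, d n ≤ ‖V a‖ ^ 2 := fun n a ha => csInf_le (hbelow n) ⟨a, ha, rfl⟩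
  have hmono : Monotone d := fun m n hmn =>
    csInf_le_csInf (hbelow m) ((hne n).image _) (Set.image_mono (hS hmn))
  have hbdd : BddAbove (Set.range d) := by
    refine ⟨R ^ 2, ?_⟩
    rintro _ ⟨n, rfl⟩
    obtain ⟨a, ha⟩ := hne n
    exact (hdle n a ha).trans (pow_le_pow_left₀ (norm_nonneg _) (hR a) 2)
  have hlim := tendsto_atTop_ciSup hmono hbdd
  set D := ⨆ n, d n
  have hdD : ∀ n, d n ≤ D := fun n => le_ciSup hbdd n
  have hex : ∀ n : ℕ, ∃ a ∈ S n, ‖V a‖ ^ 2 < d n + 1 / ((n : ℝ) + 1) := by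
    intro n
    obtain ⟨_, ⟨a, ha, rfl⟩, h⟩ := exists_lt_of_csInf_lt ((hne n).image fun a => ‖V a‖ ^ 2)
      (show d n < d n + 1 / ((n : ℝ) + 1) by
        have : 0 < 1 / ((n : ℝ) + 1) := Nat.one_div_pos_of_nat
        linarith)
    exact ⟨a, ha, h⟩
  choose a haS ha using hex
  refine ⟨a, haS, ?_⟩
  have hkey : ∀ n k l, n ≤ k → n ≤ l →
      ‖V (a k) - V (a l)‖ ^ 2 ≤ 4 * (D - d n) + 4 * (1 / ((n : ℝ) + 1)) := by
    intro n k l hk hl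
    obtain ⟨c, hc, hVc⟩ := hmid n _ (hS hk (haS k)) _ (hS hl (haS l))
    have h1 := parallelogram_law_with_norm ℝ (V (a k)) (V (a l))
    have h2 := hdle n c hc
    rw [hVc, norm_smul, mul_pow] at h2
    norm_num at h2
    have h3 : 1 / ((k : ℝ) + 1) ≤ 1 / ((n : ℝ) + 1) := by gcongr
    have h4 : 1 / ((l : ℝ) + 1) ≤ 1 / ((n : ℝ) + 1) := by gcongr
    have h5 := ha k
    have h6 := ha l
    have h7 := hdD k
    have h8 := hdD l
    nlinarith
  have hsmall : Tendsto (fun n : ℕ => 4 * (D - d n) + 4 * (1 / ((n : ℝ) + 1))) atTop (nhds 0) := by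
    have h1 := ((tendsto_const_nhds (x := D)).sub hlim).const_mul 4
    have h2 := (tendsto_one_div_add_atTop_nhds_zero_nat (𝕜 := ℝ)).const_mul 4
    simpa using h1.add h2
  refine Metric.cauchySeq_iff.2 fun ε hε => ?_
  obtain ⟨n, hn⟩ := (hsmall.eventually_lt_const (show (0 : ℝ) < ε ^ 2 by positivity)).exists
  refine ⟨n, fun k hk l hl => ?_⟩
  rw [dist_eq_norm]
  exact lt_of_pow_lt_pow_left₀ 2 hε.le ((hkey n k l hk hl).trans_lt hn)

end Compactness

section Kernels

variable {Ω X : Type*} [MeasurableSpace Ω] [MetricSpace X] [MeasurableSpace X] [BorelSpace X]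

/-- A pointwise weak limit of probability kernels is a measurable family of measures. -/
lemma measurable_of_tendsto_probabilityMeasure {P : ℕ → Ω → ProbabilityMeasure X}
    {q : Ω → ProbabilityMeasure X} (hP : ∀ n, Measurable fun ω => (P n ω : Measure X))
    (hlim : ∀ ω, Tendsto (fun n => P n ω) atTop (nhds (q ω))) :
    Measurable fun ω => (q ω : Measure X) := by
  refine Measurable.measure_of_isPiSystem_of_isProbabilityMeasure
    (S := {s | IsClosed s}) ?_ isPiSystem_isClosed fun s hs => ?_
  · rw [BorelSpace.measurable_eq (α := X), borel_eq_generateFrom_isClosed]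
  · have hδ : ∀ m : ℕ, 0 < 1 / ((m : ℝ) + 1) := fun m => Nat.one_div_pos_of_nat
    refine measurable_of_tendsto_metrizable
      (f := fun m ω => ∫⁻ x, (thickenedIndicator (hδ m) s x : ENNReal) ∂(q ω : Measure X))
      (fun m => ?_) (tendsto_pi_nhds.2 fun ω => tendsto_lintegral_thickenedIndicator_of_isClosed
        (q ω : Measure X) hs hδ tendsto_one_div_add_atTop_nhds_zero_nat)
    refine measurable_of_tendsto_metrizable
      (f := fun n ω => ∫⁻ x, (thickenedIndicator (hδ m) s x : ENNReal) ∂(P n ω : Measure X))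
      (fun n => ?_) (tendsto_pi_nhds.2 fun ω =>
        ProbabilityMeasure.tendsto_iff_forall_lintegral_tendsto.1 (hlim ω) _)
    exact (Measure.measurable_lintegral (by fun_prop)).comp (hP n)

/-- From a decreasing sequence of nonempty midpoint-closed sets of Markov kernels supported on a
random compact set one can select kernels converging fibrewise weakly almost everywhere. -/
theorem exists_kernel_limit [SecondCountableTopology X] (ℙ : Measure Ω) [IsProbabilityMeasure ℙ]
    {K : Ω → Set X} (hK : ∀ ω, IsCompact (K ω))
    {S : ℕ → Set {κ : ProbabilityTheory.Kernel Ω X // ProbabilityTheory.IsMarkovKernel κ}}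
    (hS : Antitone S) (hne : ∀ n, (S n).Nonempty)
    (hsupp : ∀ n, ∀ κ ∈ S n, ∀ᵐ ω ∂ℙ, κ.1 ω (K ω)ᶜ = 0)
    (hmid : ∀ n, ∀ κ ∈ S n, ∀ η ∈ S n, ∃ ζ ∈ S n, ∀ ω,
      ζ.1 ω = (1 / 2 : ENNReal) • κ.1 ω + (1 / 2 : ENNReal) • η.1 ω) :
    ∃ (κs : ℕ → {κ : ProbabilityTheory.Kernel Ω X // ProbabilityTheory.IsMarkovKernel κ})
      (κ : {κ : ProbabilityTheory.Kernel Ω X // ProbabilityTheory.IsMarkovKernel κ}),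
      (∀ n, κs n ∈ S n) ∧ (∀ᵐ ω ∂ℙ, κ.1 ω (K ω)ᶜ = 0) ∧
      ∀ᵐ ω ∂ℙ, ∀ f : BoundedContinuousFunction X ℝ,
        Tendsto (fun n => ∫ x, f x ∂(κs n).1 ω) atTop (nhds (∫ x, f x ∂κ.1 ω)) := by
  obtain ⟨g, hg1, hg⟩ := exists_separating_seq X
  have hM : ∀ κ : {κ : ProbabilityTheory.Kernel Ω X // ProbabilityTheory.IsMarkovKernel κ},
      ∀ ω, IsProbabilityMeasure (κ.1 ω) := fun κ ω => κ.2.isProbabilityMeasure ω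
  set ν : Measure (ℕ × Ω) := ((Measure.count : Measure ℕ).toFinite).prod ℙ
  let v : {κ : ProbabilityTheory.Kernel Ω X // ProbabilityTheory.IsMarkovKernel κ} → ℕ × Ω → ℝ :=
    fun κ i => ∫ x, g i.1 x ∂κ.1 i.2
  have hvm : ∀ κ, Measurable (v κ) := fun κ => measurable_from_prod_countable_right fun j =>
    (StronglyMeasurable.integral_kernel (κ := κ.1)
      (g j).continuous.measurable.stronglyMeasurable).measurable
  have hvb : ∀ κ i, ‖v κ i‖ ≤ 1 := fun κ i => by
    have := hM κ i.2
    have h := norm_integral_le_of_norm_le_const (μ := κ.1 i.2) (f := g i.1) (C := 1)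
      (Eventually.of_forall (hg1 i.1))
    simpa using h
  have hvL : ∀ κ, MemLp (v κ) 2 ν := fun κ =>
    MemLp.of_bound (hvm κ).aestronglyMeasurable 1 (Eventually.of_forall (hvb κ))
  let V : {κ : ProbabilityTheory.Kernel Ω X // ProbabilityTheory.IsMarkovKernel κ} → Lp ℝ 2 ν :=
    fun κ => (hvL κ).toLp (v κ)
  obtain ⟨a, haS, ha⟩ := exists_cauchySeq_of_midpoint (V := V) hS hne
    (R := (measureUnivNNReal ν : ℝ) ^ (2 : ENNReal).toReal⁻¹ * 1) (fun κ => by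
      refine (Lp.norm_le_of_ae_bound (f := V κ) zero_le_one ?_)
      filter_upwards [(hvL κ).coeFn_toLp] with i hi
      simpa [V, hi] using hvb κ i) (fun n κ hκ η hη => by
      obtain ⟨ζ, hζ, h⟩ := hmid n κ hκ η hη
      refine ⟨ζ, hζ, ?_⟩
      have hv : v ζ = (1 / 2 : ℝ) • (v κ + v η) := by
        funext i
        have := hM κ i.2
        have := hM η i.2
        have hi : ∀ (τ : Measure X) [IsProbabilityMeasure τ],
            Integrable (g i.1) ((1 / 2 : ENNReal) • τ) := fun τ _ =>
          ((g i.1).integrable τ).smul_measure (by simp)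
        simp only [v, h, Pi.smul_apply, Pi.add_apply, smul_eq_mul]
        rw [integral_add_measure (hi _) (hi _), integral_smul_measure, integral_smul_measure]
        simp
        ring
      calc V ζ = ((((hvL κ).add (hvL η)).const_smul (1 / 2 : ℝ))).toLp _ :=
            MemLp.toLp_congr _ _ (Eventually.of_forall fun i => congrFun hv i)
        _ = _ := rfl)
  obtain ⟨L, hL⟩ := cauchySeq_tendsto_of_complete ha
  obtain ⟨ns, hns, hae⟩ := (tendstoInMeasure_of_tendsto_Lp hL).exists_seq_tendsto_ae
  have hae2 : ∀ᵐ i ∂ν, ∃ l, Tendsto (fun n => v (a (ns n)) i) atTop (nhds l) := by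
    have : ∀ᵐ i ∂ν, ∀ n, V (a (ns n)) i = v (a (ns n)) i :=
      ae_all_iff.2 fun n => (hvL _).coeFn_toLp
    filter_upwards [hae, this] with i h1 h2
    exact ⟨_, by simpa only [h2] using h1⟩
  have hae3 : ∀ᵐ ω ∂ℙ, ∀ j, ∃ l, Tendsto (fun n => v (a (ns n)) (j, ω)) atTop (nhds l) := by
    have h := Measure.ae_ae_of_ae_prod hae2
    rw [ae_toFinite, Measure.ae_count_iff] at h
    exact ae_all_iff.2 h
  have hae4 : ∀ᵐ ω ∂ℙ, ∀ n, (a (ns n)).1 ω (K ω)ᶜ = 0 :=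
    ae_all_iff.2 fun n => hsupp _ _ (haS (ns n))
  let P : ℕ → Ω → ProbabilityMeasure X := fun n ω => ⟨(a (ns n)).1 ω, hM _ ω⟩
  have hae5 : ∀ᵐ ω ∂ℙ, ∃ q : ProbabilityMeasure X,
      Tendsto (fun n => P n ω) atTop (nhds q) ∧ (q : Measure X) (K ω)ᶜ = 0 := by
    filter_upwards [hae3, hae4] with ω h3 h4
    exact exists_tendsto_of_separating hg (hK ω) (p := fun n => P n ω) h4 h3
  obtain ⟨N, hN, hNm, hN0⟩ := exists_measurable_superset_of_null (ae_iff.1 hae5)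
  have hgood : ∀ ω, ∃ q : ProbabilityMeasure X, (ω ∈ N → q = P 0 ω) ∧ (ω ∉ N →
      Tendsto (fun n => P n ω) atTop (nhds q) ∧ (q : Measure X) (K ω)ᶜ = 0) := by
    intro ω
    by_cases hω : ω ∈ N
    · exact ⟨P 0 ω, fun _ => rfl, fun h => absurd hω h⟩
    · obtain ⟨q, hq⟩ := not_not.1 fun h => hω (hN h)
      exact ⟨q, fun h => absurd h hω, fun _ => hq⟩
  choose q hqN hq using hgood
  classical
  have hqm : Measurable fun ω => (q ω : Measure X) := by
    refine measurable_of_tendsto_probabilityMeasure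
      (P := fun n ω => if ω ∈ N then P 0 ω else P n ω) (fun n => ?_) (fun ω => ?_)
    · have : (fun ω => ((if ω ∈ N then P 0 ω else P n ω : ProbabilityMeasure X) : Measure X)) =
          fun ω => if ω ∈ N then (a (ns 0)).1 ω else (a (ns n)).1 ω := by
        funext ω
        split_ifs <;> rfl
      rw [this]
      exact Measurable.ite hNm (a (ns 0)).1.measurable (a (ns n)).1.measurable
    · by_cases hω : ω ∈ N
      · simp only [hω, if_true, hqN ω hω]
        exact tendsto_const_nhds
      · simp only [hω, if_false]
        exact (hq ω hω).1
  have hNae : ∀ᵐ ω ∂ℙ, ω ∉ N := measure_eq_zero_iff_ae_notMem.1 hN0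
  refine ⟨fun n => a (ns n), ⟨⟨fun ω => (q ω : Measure X), hqm⟩, ⟨fun ω => (q ω).2⟩⟩,
    fun n => hS hns.le_apply (haS _), ?_, ?_⟩
  · filter_upwards [hNae] with ω hω
    exact (hq ω hω).2
  · filter_upwards [hNae] with ω hω
    exact ProbabilityMeasure.tendsto_iff_forall_integral_tendsto.1 (hq ω hω).1

end Kernels

section CompProd

variable {Ω X : Type*} [MeasurableSpace Ω] [MeasurableSpace X]
  {ℙ : Measure Ω} {K : Ω → Set X} {f : Ω → X → ℝ} {h : Ω → ℝ}

lemma ae_norm_le_of_marginal {μ : Measure (Ω × X)} (hK : ∀ᵐ p ∂μ, p.2 ∈ K p.1)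
    (hfh : ∀ ω, ∀ x ∈ K ω, |f ω x| ≤ h ω) :
    ∀ᵐ p ∂μ, ‖f p.1 p.2‖ ≤ h p.1 := by
  filter_upwards [hK] with p hp
  exact hfh _ _ hp

lemma integrable_comp_fst {μ : Measure (Ω × X)} (hμ : μ.map Prod.fst = ℙ) (hh : Integrable h ℙ) :
    Integrable (fun p : Ω × X => h p.1) μ := by
  rw [← hμ] at hh
  exact hh.comp_measurable measurable_fst

lemma integral_comp_fst {μ : Measure (Ω × X)} (hμ : μ.map Prod.fst = ℙ) (hh : Integrable h ℙ) :
    ∫ p, h p.1 ∂μ = ∫ ω, h ω ∂ℙ := by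
  rw [← hμ] at hh ⊢
  rw [integral_map measurable_fst.aemeasurable hh.aestronglyMeasurable]

lemma integrable_of_marginal {μ : Measure (Ω × X)} (hμ : μ.map Prod.fst = ℙ)
    (hK : ∀ᵐ p ∂μ, p.2 ∈ K p.1) (hf : Measurable fun p : Ω × X => f p.1 p.2)
    (hh : Integrable h ℙ) (hfh : ∀ ω, ∀ x ∈ K ω, |f ω x| ≤ h ω) :
    Integrable (fun p : Ω × X => f p.1 p.2) μ :=
  (integrable_comp_fst hμ hh).mono' hf.aestronglyMeasurable (ae_norm_le_of_marginal hK hfh)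

lemma abs_integral_le_of_marginal {μ : Measure (Ω × X)} (hμ : μ.map Prod.fst = ℙ)
    (hK : ∀ᵐ p ∂μ, p.2 ∈ K p.1) (hh : Integrable h ℙ)
    (hfh : ∀ ω, ∀ x ∈ K ω, |f ω x| ≤ h ω) :
    |∫ p, f p.1 p.2 ∂μ| ≤ ∫ ω, h ω ∂ℙ := by
  rw [← integral_comp_fst hμ hh]
  exact norm_integral_le_of_norm_le (integrable_comp_fst hμ hh) (ae_norm_le_of_marginal hK hfh)

lemma ae_compProd_mem_iff [SFinite ℙ] {κ : ProbabilityTheory.Kernel Ω X}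
    [ProbabilityTheory.IsMarkovKernel κ] (hK : MeasurableSet {p : Ω × X | p.2 ∈ K p.1}) :
    (∀ᵐ p ∂(ℙ.compProd κ), p.2 ∈ K p.1) ↔ ∀ᵐ ω ∂ℙ, κ ω (K ω)ᶜ = 0 :=
  Measure.ae_compProd_iff hK

lemma compProd_half_add_half [SFinite ℙ] {κ η ζ : ProbabilityTheory.Kernel Ω X}
    [ProbabilityTheory.IsMarkovKernel κ] [ProbabilityTheory.IsMarkovKernel η]
    [ProbabilityTheory.IsMarkovKernel ζ]
    (h : ∀ ω, ζ ω = (1 / 2 : ENNReal) • κ ω + (1 / 2 : ENNReal) • η ω) :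
    ℙ.compProd ζ = (1 / 2 : ENNReal) • ℙ.compProd κ + (1 / 2 : ENNReal) • ℙ.compProd η := by
  ext s hs
  rw [Measure.add_apply, Measure.smul_apply, Measure.smul_apply, Measure.compProd_apply hs,
    Measure.compProd_apply hs, Measure.compProd_apply hs]
  simp only [h, Measure.add_apply, Measure.smul_apply, smul_eq_mul]
  have hm : ∀ τ : ProbabilityTheory.Kernel Ω X, ProbabilityTheory.IsMarkovKernel τ →
      Measurable fun ω => τ ω (Prod.mk ω ⁻¹' s) := fun τ _ =>
    ProbabilityTheory.Kernel.measurable_kernel_prodMk_left hs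
  rw [lintegral_add_left ((hm κ inferInstance).const_mul _),
    lintegral_const_mul _ (hm κ inferInstance), lintegral_const_mul _ (hm η inferInstance)]

/-- The average of two Markov kernels. -/
lemma exists_kernel_midpoint (κ η : ProbabilityTheory.Kernel Ω X)
    [ProbabilityTheory.IsMarkovKernel κ] [ProbabilityTheory.IsMarkovKernel η] :
    ∃ ζ : ProbabilityTheory.Kernel Ω X, ProbabilityTheory.IsMarkovKernel ζ ∧
      ∀ ω, ζ ω = (1 / 2 : ENNReal) • κ ω + (1 / 2 : ENNReal) • η ω := by
  refine ⟨⟨fun ω => (1 / 2 : ENNReal) • κ ω + (1 / 2 : ENNReal) • η ω, ?_⟩, ⟨fun ω => ⟨?_⟩⟩,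
    fun ω => rfl⟩
  · refine Measure.measurable_of_measurable_coe _ fun s hs => ?_
    simp only [Measure.add_apply, Measure.smul_apply, smul_eq_mul]
    exact ((κ.measurable_coe hs).const_mul _).add ((η.measurable_coe hs).const_mul _)
  · change ((1 / 2 : ENNReal) • κ ω + (1 / 2 : ENNReal) • η ω) Set.univ = 1
    simp [ENNReal.inv_two_add_inv_two]

lemma integral_half_add_half {Y : Type*} [MeasurableSpace Y] {μ ν : Measure Y} {F : Y → ℝ}
    (hμ : Integrable F μ) (hν : Integrable F ν) :
    ∫ y, F y ∂((1 / 2 : ENNReal) • μ + (1 / 2 : ENNReal) • ν) =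
      (1 / 2) * ∫ y, F y ∂μ + (1 / 2) * ∫ y, F y ∂ν := by
  rw [integral_add_measure (hμ.smul_measure (by simp)) (hν.smul_measure (by simp)),
    integral_smul_measure, integral_smul_measure]
  simp

/-- Fibrewise weak convergence implies convergence of integrals of dominated random continuous
functions. -/
lemma tendsto_integral_compProd [TopologicalSpace X] [BorelSpace X] [IsProbabilityMeasure ℙ]
    {κs : ℕ → ProbabilityTheory.Kernel Ω X} {κ : ProbabilityTheory.Kernel Ω X}
    [∀ n, ProbabilityTheory.IsMarkovKernel (κs n)] [ProbabilityTheory.IsMarkovKernel κ]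
    (hK : MeasurableSet {p : Ω × X | p.2 ∈ K p.1}) (hKne : ∀ ω, (K ω).Nonempty)
    (hκs : ∀ n, ∀ᵐ ω ∂ℙ, κs n ω (K ω)ᶜ = 0) (hκ : ∀ᵐ ω ∂ℙ, κ ω (K ω)ᶜ = 0)
    (hlim : ∀ᵐ ω ∂ℙ, ∀ f : BoundedContinuousFunction X ℝ,
        Tendsto (fun n => ∫ x, f x ∂κs n ω) atTop (nhds (∫ x, f x ∂κ ω)))
    (hf : Measurable fun p : Ω × X => f p.1 p.2) (hfc : ∀ ω, Continuous (f ω))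
    (hh : Integrable h ℙ) (hfh : ∀ ω, ∀ x ∈ K ω, |f ω x| ≤ h ω) :
    Tendsto (fun n => ∫ p, f p.1 p.2 ∂(ℙ.compProd (κs n))) atTop
      (nhds (∫ p, f p.1 p.2 ∂(ℙ.compProd κ))) := by
  have hfst : ∀ τ : ProbabilityTheory.Kernel Ω X, ProbabilityTheory.IsMarkovKernel τ →
      (ℙ.compProd τ).map Prod.fst = ℙ := fun τ _ => Measure.fst_compProd ℙ τ
  have hi : ∀ τ : ProbabilityTheory.Kernel Ω X, ProbabilityTheory.IsMarkovKernel τ →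
      (∀ᵐ ω ∂ℙ, τ ω (K ω)ᶜ = 0) →
      ∫ p, f p.1 p.2 ∂(ℙ.compProd τ) = ∫ ω, ∫ x, f ω x ∂τ ω ∂ℙ := fun τ _ hτ =>
    Measure.integral_compProd (f := fun p : Ω × X => f p.1 p.2)
      (integrable_of_marginal (hfst τ inferInstance) ((ae_compProd_mem_iff hK).2 hτ) hf hh hfh)
  simp only [hi _ inferInstance hκ, hi _ inferInstance (hκs _)]
  refine tendsto_integral_of_dominated_convergence h (fun n => ?_) hh (fun n => ?_) ?_
  · exact (StronglyMeasurable.integral_kernel_prod_right'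
      (κ := κs n) hf.stronglyMeasurable).aestronglyMeasurable
  · filter_upwards [hκs n] with ω hω
    refine (norm_integral_le_of_norm_le_const (C := h ω) ?_).trans (by simp)
    filter_upwards [mem_ae_iff.2 hω] with x hx
    exact hfh ω x hx
  · filter_upwards [ae_all_iff.2 hκs, hκ, hlim] with ω hs h0 hl
    obtain ⟨z, hz⟩ := hKne ω
    have hh0 : 0 ≤ h ω := (abs_nonneg _).trans (hfh ω z hz)
    let F : BoundedContinuousFunction X ℝ := BoundedContinuousFunction.ofNormedAddCommGroup
      (fun x => max (-(h ω)) (min (h ω) (f ω x))) (by have := hfc ω; fun_prop) (h ω) (fun x => by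
        rw [Real.norm_eq_abs, abs_le]
        exact ⟨le_max_left _ _, max_le (by linarith) (min_le_left _ _)⟩)
    have hF : ∀ x ∈ K ω, F x = f ω x := fun x hx => by
      have := abs_le.1 (hfh ω x hx)
      change max (-(h ω)) (min (h ω) (f ω x)) = f ω x
      rw [min_eq_right this.2, max_eq_right this.1]
    have hint : ∀ τ : Measure X, τ (K ω)ᶜ = 0 → ∫ x, F x ∂τ = ∫ x, f ω x ∂τ := fun τ hτ =>
      integral_congr_ae (by filter_upwards [mem_ae_iff.2 hτ] with x hx using hF x hx)
    have := hl F
    simpa only [hint _ h0, hint _ (hs _)] using this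

end CompProd

section Averaging

variable {Y : Type*} {T : Y → Y} {u : ℕ → Y → ℝ}

lemma sum_subadditive_iterate_le (hu : ∀ n m y, u (n + m) y ≤ u m y + u n (T^[m] y)) (M n : ℕ) :
    ∀ y, ∑ s ∈ Finset.range (M + 1), u (n + M - s) (T^[s] y) ≤
      birkhoffSum T (u (M + 1)) n y + ∑ s ∈ Finset.range (M + 1), u (M - s) (T^[n + s] y) := by
  induction n with
  | zero => intro y; simp
  | succ n ih =>
    intro y
    have h1 := ih (T y)
    rw [Finset.sum_range_succ] at h1
    rw [Finset.sum_range_succ', birkhoffSum_succ']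
    have h2 := hu n (M + 1) y
    have e1 : ∀ s, n + 1 + M - (s + 1) = n + M - s := fun s => by omega
    have e2 : n + M - M = n := by omega
    have e3 : n + 1 + M - 0 = n + (M + 1) := by omega
    have e4 : ∀ s, n + 1 + s = n + s + 1 := fun s => by omega
    simp only [e1, e3]
    simp only [e4, iterate_succ_apply, iterate_zero, id_eq]
    rw [e2] at h1
    rw [iterate_succ_apply] at h2
    linarith

/-- Averaging a subadditive cocycle over blocks of length `M + 1`. -/
lemma mul_subadditive_le (hu : ∀ n m y, u (n + m) y ≤ u m y + u n (T^[m] y)) (M n : ℕ) (y : Y) :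
    ((M : ℝ) + 1) * u (n + M) y ≤ ∑ s ∈ Finset.range (M + 1), u s y +
      birkhoffSum T (u (M + 1)) n y + ∑ s ∈ Finset.range (M + 1), u (M - s) (T^[n + s] y) := by
  have h1 := sum_subadditive_iterate_le hu M n y
  have h2 : ∑ s ∈ Finset.range (M + 1), u (n + M) y ≤
      ∑ s ∈ Finset.range (M + 1), (u s y + u (n + M - s) (T^[s] y)) := by
    refine Finset.sum_le_sum fun s hs => ?_
    have := hu (n + M - s) s y
    rwa [Nat.sub_add_cancel (by have := Finset.mem_range.1 hs; omega)] at this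
  rw [Finset.sum_add_distrib, Finset.sum_const, Finset.card_range, nsmul_eq_mul] at h2
  push_cast at h2
  linarith

end Averaging

section OrbitAverage

variable {Y : Type*} [MeasurableSpace Y] {T : Y → Y} {ρ : Measure Y} {N : ℕ} {F : Y → ℝ}

/-- The average of the first `N` push-forwards of `ρ` under `T`. -/
noncomputable def orbitAverage (T : Y → Y) (ρ : Measure Y) (N : ℕ) : Measure Y :=
  (N : ENNReal)⁻¹ • ∑ k ∈ Finset.range N, ρ.map T^[k]

lemma ae_orbitAverage {p : Y → Prop} (h : ∀ k, ∀ᵐ y ∂(ρ.map T^[k]), p y) :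
    ∀ᵐ y ∂(orbitAverage T ρ N), p y := by
  refine Measure.ae_smul_measure ?_ _
  rw [ae_finsetSum_measure_iff]
  exact fun k _ => h k

lemma map_orbitAverage {Z : Type*} [MeasurableSpace Z] {π : Y → Z} {τ : Measure Z}
    (hT : Measurable T) (hπ : Measurable π) (hN : N ≠ 0) (h : ∀ k, ρ.map (π ∘ T^[k]) = τ) :
    (orbitAverage T ρ N).map π = τ := by
  have h2 : ∀ k, (ρ.map T^[k]).map π = τ := fun k => by
    rw [Measure.map_map hπ (hT.iterate k), h]
  rw [orbitAverage, Measure.map_smul, Measure.map_finset_sum hπ.aemeasurable]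
  simp only [h2, Finset.sum_const, Finset.card_range]
  rw [← Nat.cast_smul_eq_nsmul ENNReal, smul_smul, ENNReal.inv_mul_cancel (by simpa) (by simp),
    one_smul]

lemma integral_orbitAverage (hT : Measurable T) (hF : Measurable F)
    (hFi : ∀ k, Integrable (fun y => F (T^[k] y)) ρ) :
    ∫ y, F y ∂(orbitAverage T ρ N) = (N : ℝ)⁻¹ * ∫ y, birkhoffSum T F N y ∂ρ := by
  have hi : ∀ k, Integrable F (ρ.map T^[k]) := fun k =>
    (integrable_map_measure hF.aestronglyMeasurable (hT.iterate k).aemeasurable).2 (hFi k)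
  simp only [birkhoffSum]
  rw [orbitAverage, integral_smul_measure, integral_finsetSum_measure fun k _ => hi k,
    integral_finsetSum _ fun k _ => hFi k]
  simp only [smul_eq_mul, ENNReal.toReal_inv, ENNReal.toReal_natCast]
  congr 1
  exact Finset.sum_congr rfl fun k _ =>
    integral_map (hT.iterate k).aemeasurable hF.aestronglyMeasurable

lemma abs_integral_comp_sub_orbitAverage_le [IsProbabilityMeasure ρ] (hT : Measurable T)
    (hF : Measurable F) {c : ℝ} (hc : ∀ y, |F y| ≤ c) :
    |∫ y, F (T y) ∂(orbitAverage T ρ N) - ∫ y, F y ∂(orbitAverage T ρ N)| ≤ 2 * c * (N : ℝ)⁻¹ := by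
  have hi : ∀ G : Y → ℝ, Measurable G → (∀ y, |G y| ≤ c) → Integrable G ρ := fun G hG h =>
    Integrable.of_bound hG.aestronglyMeasurable c (Eventually.of_forall h)
  have hb : ∀ G : Y → ℝ, Measurable G → (∀ y, |G y| ≤ c) →
      Integrable (fun y => birkhoffSum T G N y) ρ := fun G hG h =>
    integrable_finsetSum _ fun k _ => hi (fun y => G (T^[k] y)) (hG.comp (hT.iterate k)) fun y => h _
  rw [integral_orbitAverage (F := fun y => F (T y)) hT (hF.comp hT) fun k =>
      hi (fun y => F (T (T^[k] y))) (hF.comp (hT.comp (hT.iterate k))) fun y => hc _,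
    integral_orbitAverage hT hF fun k =>
      hi (fun y => F (T^[k] y)) (hF.comp (hT.iterate k)) fun y => hc _,
    ← mul_sub, ← integral_sub (hb (fun y => F (T y)) (hF.comp hT) fun y => hc _) (hb F hF hc),
    abs_mul, abs_of_nonneg (by positivity : (0 : ℝ) ≤ (N : ℝ)⁻¹), mul_comm]
  refine mul_le_mul_of_nonneg_right ?_ (by positivity)
  have := norm_integral_le_of_norm_le_const (μ := ρ) (C := 2 * c)
    (f := fun y => birkhoffSum T (fun y => F (T y)) N y - birkhoffSum T F N y)
    (Eventually.of_forall fun y => by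
      have e : birkhoffSum T (fun y => F (T y)) N y = birkhoffSum T F N (T y) := by
        simp only [birkhoffSum, ← iterate_succ_apply', iterate_succ_apply]
      rw [e, birkhoffSum_apply_sub_birkhoffSum, Real.norm_eq_abs, two_mul]
      exact (abs_sub _ _).trans (add_le_add (hc _) (hc _)))
  simpa using this

end OrbitAverage

section System

/-- A subadditive sequence of random continuous functions over a discrete-time random dynamical
system, integrable on a forward invariant random compact set. -/
structure IsSubadditiveRDS {Ω X : Type*} [MeasurableSpace Ω] [MetricSpace X] [MeasurableSpace X]
    (ℙ : Measure Ω) (θ : Ω → Ω) (φ : ℕ → Ω → X → X) (K : Ω → Set X) (Φ : ℕ → Ω → X → ℝ) :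
    Prop where
  ergodic : Ergodic θ ℙ
  measurable : Measurable fun p : ℕ × Ω × X => φ p.1 p.2.1 p.2.2
  zero : ∀ ω, φ 0 ω = id
  cocycle : ∀ (n m : ℕ) (ω : Ω), φ (n + m) ω = φ n (θ^[m] ω) ∘ φ m ω
  continuous : ∀ n ω, Continuous (φ n ω)
  isRandomCompact : IsRandomCompact K
  forward_invariant : ∀ᵐ ω ∂ℙ, φ 1 ω '' K ω ⊆ K (θ ω)
  isCaratheodory : ∀ n, IsCaratheodory (Φ n)
  subadditive : ∀ (n m : ℕ) (ω : Ω) (x : X),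
    Φ (n + m) ω x ≤ Φ m ω x + Φ n (θ^[m] ω) (φ m ω x)
  integrable : ∀ n, Integrable (fun ω => sSup ((fun x => |Φ n ω x|) '' K ω)) ℙ

/-- The skew product of a random dynamical system. -/
def skew {Ω X : Type*} (θ : Ω → Ω) (φ : ℕ → Ω → X → X) (p : Ω × X) : Ω × X :=
  (θ p.1, φ 1 p.1 p.2)

/-- The maximum of `|f ω|` over `K ω`. -/
noncomputable def maxAbs {Ω X : Type*} (K : Ω → Set X) (f : Ω → X → ℝ) (ω : Ω) : ℝ :=
  sSup ((fun x => |f ω x|) '' K ω)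

/-- The maximum of `f ω` over `K ω`. -/
noncomputable def maxVal {Ω X : Type*} (K : Ω → Set X) (f : Ω → X → ℝ) (ω : Ω) : ℝ :=
  sSup (f ω '' K ω)

variable {Ω X : Type*} [MeasurableSpace Ω] [MetricSpace X]
  {K : Ω → Set X} {f : Ω → X → ℝ}

lemma abs_le_maxAbs (hK : IsRandomCompact K) (hf : IsCaratheodory f) :
    ∀ ω, ∀ x ∈ K ω, |f ω x| ≤ maxAbs K f ω := fun ω x hx =>
  le_csSup ((hK.isCompact ω).image (hf.continuous ω).abs).bddAbove ⟨x, hx, rfl⟩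

lemma le_maxVal (hK : IsRandomCompact K) (hf : IsCaratheodory f) :
    ∀ ω, ∀ x ∈ K ω, f ω x ≤ maxVal K f ω := fun ω x hx =>
  le_csSup ((hK.isCompact ω).image (hf.continuous ω)).bddAbove ⟨x, hx, rfl⟩

lemma maxAbs_nonneg (hK : IsRandomCompact K) (hf : IsCaratheodory f) (ω : Ω) :
    0 ≤ maxAbs K f ω := by
  obtain ⟨x, hx⟩ := hK.nonempty ω
  exact (abs_nonneg _).trans (abs_le_maxAbs hK hf ω x hx)

lemma abs_maxVal_le (hK : IsRandomCompact K) (hf : IsCaratheodory f) (ω : Ω) :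
    |maxVal K f ω| ≤ maxAbs K f ω := by
  obtain ⟨x, hx⟩ := hK.nonempty ω
  rw [abs_le]
  refine ⟨(abs_le.1 (abs_le_maxAbs hK hf ω x hx)).1.trans (le_maxVal hK hf ω x hx),
    csSup_le ((hK.nonempty ω).image _) ?_⟩
  rintro _ ⟨z, hz, rfl⟩
  exact (le_abs_self _).trans (abs_le_maxAbs hK hf ω z hz)

lemma measurable_maxAbs [SecondCountableTopology X] (hK : IsRandomCompact K)
    (hf : IsCaratheodory f) : Measurable (maxAbs K f) :=
  hK.measurable_sSup_image hf.abs

lemma measurable_maxVal [SecondCountableTopology X] (hK : IsRandomCompact K)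
    (hf : IsCaratheodory f) : Measurable (maxVal K f) :=
  hK.measurable_sSup_image hf

namespace IsSubadditiveRDS

variable [MeasurableSpace X] {ℙ : Measure Ω} {θ : Ω → Ω} {φ : ℕ → Ω → X → X} {Φ : ℕ → Ω → X → ℝ}

lemma skew_iterate (h : IsSubadditiveRDS ℙ θ φ K Φ) (n : ℕ) (p : Ω × X) :
    (skew θ φ)^[n] p = (θ^[n] p.1, φ n p.1 p.2) := by
  induction n with
  | zero => simp [h.zero]
  | succ n ih =>
    rw [iterate_succ_apply', ih, skew, add_comm n 1, h.cocycle 1 n, add_comm 1 n,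
      iterate_succ_apply', comp_apply]

lemma measurable_map (h : IsSubadditiveRDS ℙ θ φ K Φ) (n : ℕ) :
    Measurable fun p : Ω × X => φ n p.1 p.2 :=
  h.measurable.comp (f := fun p : Ω × X => (n, p)) (by fun_prop)

lemma measurable_skew (h : IsSubadditiveRDS ℙ θ φ K Φ) : Measurable (skew θ φ) :=
  (h.ergodic.measurable.comp measurable_fst).prodMk (h.measurable_map 1)

lemma subadditive_skew (h : IsSubadditiveRDS ℙ θ φ K Φ) (n m : ℕ) (p : Ω × X) :
    Φ (n + m) p.1 p.2 ≤
      Φ m p.1 p.2 + Φ n ((skew θ φ)^[m] p).1 ((skew θ φ)^[m] p).2 := by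
  rw [h.skew_iterate]
  exact h.subadditive n m p.1 p.2

lemma ae_iterate_mem (h : IsSubadditiveRDS ℙ θ φ K Φ) :
    ∀ᵐ ω ∂ℙ, ∀ k, ∀ x ∈ K ω, φ k ω x ∈ K (θ^[k] ω) := by
  have h1 : ∀ᵐ ω ∂ℙ, ∀ k, φ 1 (θ^[k] ω) '' K (θ^[k] ω) ⊆ K (θ (θ^[k] ω)) :=
    ae_all_iff.2 fun k =>
      (h.ergodic.toMeasurePreserving.iterate k).quasiMeasurePreserving.ae h.forward_invariant
  filter_upwards [h1] with ω hω k
  induction k with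
  | zero => intro x hx; simpa [h.zero] using hx
  | succ k ih =>
    intro x hx
    rw [add_comm k 1, h.cocycle 1 k, add_comm 1 k, iterate_succ_apply', comp_apply]
    exact hω k ⟨_, ih x hx, rfl⟩

lemma integrable_maxVal [SecondCountableTopology X] (h : IsSubadditiveRDS ℙ θ φ K Φ) (n : ℕ) :
    Integrable (maxVal K (Φ n)) ℙ :=
  (h.integrable n).mono' (measurable_maxVal h.isRandomCompact (h.isCaratheodory n)).aestronglyMeasurable
    (Eventually.of_forall (abs_maxVal_le h.isRandomCompact (h.isCaratheodory n)))

end IsSubadditiveRDS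

end System

section Optimal

variable {Ω X : Type*} [MeasurableSpace Ω] [MetricSpace X] [MeasurableSpace X]
  {ℙ : Measure Ω} {θ : Ω → Ω} {φ : ℕ → Ω → X → X} {K : Ω → Set X} {Φ : ℕ → Ω → X → ℝ} {lam : ℝ}

/-- The boundary error of block averaging with blocks of length `M + 1`. -/
noncomputable def blockError (ℙ : Measure Ω) (K : Ω → Set X) (Φ : ℕ → Ω → X → ℝ) (M : ℕ) : ℝ :=
  ∑ s ∈ Finset.range (M + 1), ∫ ω, maxAbs K (Φ s) ω ∂ℙ +
    ∑ s ∈ Finset.range (M + 1), ∫ ω, maxAbs K (Φ (M - s)) ω ∂ℙ +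
    ∑ _s ∈ Finset.range M, ∫ ω, maxAbs K (Φ (M + 1)) ω ∂ℙ

lemma IsSubadditiveRDS.blockError_nonneg (h : IsSubadditiveRDS ℙ θ φ K Φ) (M : ℕ) :
    0 ≤ blockError ℙ K Φ M := by
  have hA : ∀ n, 0 ≤ ∫ ω, maxAbs K (Φ n) ω ∂ℙ := fun n =>
    integral_nonneg (maxAbs_nonneg h.isRandomCompact (h.isCaratheodory n))
  exact add_nonneg (add_nonneg (Finset.sum_nonneg fun s _ => hA _)
    (Finset.sum_nonneg fun s _ => hA _)) (Finset.sum_nonneg fun s _ => hA _)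

/-- Measures on the graph of `K` with marginal `ℙ` which are invariant up to an error `1 / N` and
whose integrals of `Φ m` are almost at least `m * lam`. -/
structure IsAlmostOptimal (ℙ : Measure Ω) (θ : Ω → Ω) (φ : ℕ → Ω → X → X) (K : Ω → Set X)
    (Φ : ℕ → Ω → X → ℝ) (lam : ℝ) (N : ℕ) (μ : Measure (Ω × X)) : Prop where
  map_fst : μ.map Prod.fst = ℙ
  ae_mem : ∀ᵐ p ∂μ, p.2 ∈ K p.1
  abs_sub_le : ∀ (c : ℝ) (F : Ω × X → ℝ), 0 ≤ c → Measurable F → (∀ p, |F p| ≤ c) →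
    |∫ p, F (skew θ φ p) ∂μ - ∫ p, F p ∂μ| ≤ 2 * c * (N : ℝ)⁻¹
  le_integral : ∀ M ≤ N, (M + 1) * lam - blockError ℙ K Φ M * (N : ℝ)⁻¹ ≤
    ∫ p, Φ (M + 1) p.1 p.2 ∂μ

lemma IsAlmostOptimal.mono (h : IsSubadditiveRDS ℙ θ φ K Φ) {N N' : ℕ} (hN : 0 < N)
    (hNN' : N ≤ N') {μ : Measure (Ω × X)} (hμ : IsAlmostOptimal ℙ θ φ K Φ lam N' μ) :
    IsAlmostOptimal ℙ θ φ K Φ lam N μ := by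
  have hinv : (N' : ℝ)⁻¹ ≤ (N : ℝ)⁻¹ := by gcongr
  refine ⟨hμ.map_fst, hμ.ae_mem, fun c F hc0 hF hc => (hμ.abs_sub_le c F hc0 hF hc).trans ?_,
    fun M hM => le_trans ?_ (hμ.le_integral M (hM.trans hNN'))⟩
  · gcongr
  · have := h.blockError_nonneg M
    gcongr

lemma IsAlmostOptimal.midpoint [SecondCountableTopology X] [BorelSpace X]
    [IsProbabilityMeasure ℙ] (h : IsSubadditiveRDS ℙ θ φ K Φ) {N : ℕ}
    {μ ν : Measure (Ω × X)} [IsProbabilityMeasure μ] [IsProbabilityMeasure ν]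
    (hμ : IsAlmostOptimal ℙ θ φ K Φ lam N μ) (hν : IsAlmostOptimal ℙ θ φ K Φ lam N ν) :
    IsAlmostOptimal ℙ θ φ K Φ lam N ((1 / 2 : ENNReal) • μ + (1 / 2 : ENNReal) • ν) := by
  refine ⟨?_, ?_, fun c F hc0 hF hc => ?_, fun M hM => ?_⟩
  · rw [Measure.map_add _ _ measurable_fst, Measure.map_smul, Measure.map_smul, hμ.map_fst,
      hν.map_fst, ← add_smul]
    simp [ENNReal.inv_two_add_inv_two]
  · rw [ae_add_measure_iff]
    exact ⟨Measure.ae_smul_measure hμ.ae_mem _, Measure.ae_smul_measure hν.ae_mem _⟩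
  · have hi : ∀ τ : Measure (Ω × X), IsProbabilityMeasure τ → ∀ G : Ω × X → ℝ, Measurable G →
        (∀ p, |G p| ≤ c) → Integrable G τ := fun τ _ G hG hGc =>
      Integrable.of_bound hG.aestronglyMeasurable c (Eventually.of_forall hGc)
    have hFs : Measurable fun p => F (skew θ φ p) := hF.comp h.measurable_skew
    rw [integral_half_add_half (hi μ inferInstance F hF hc) (hi ν inferInstance F hF hc),
      integral_half_add_half (hi μ inferInstance _ hFs fun p => hc _)
        (hi ν inferInstance _ hFs fun p => hc _)]
    have h1 := abs_le.1 (hμ.abs_sub_le c F hc0 hF hc)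
    have h2 := abs_le.1 (hν.abs_sub_le c F hc0 hF hc)
    rw [abs_le]
    constructor <;> linarith [h1.1, h1.2, h2.1, h2.2]
  · have hi : ∀ τ : Measure (Ω × X), IsAlmostOptimal ℙ θ φ K Φ lam N τ →
        Integrable (fun p : Ω × X => Φ (M + 1) p.1 p.2) τ := fun τ hτ =>
      integrable_of_marginal hτ.map_fst hτ.ae_mem (h.isCaratheodory _).measurable_uncurry
        (h.integrable (M + 1)) (abs_le_maxAbs h.isRandomCompact (h.isCaratheodory _))
    rw [integral_half_add_half (hi μ hμ) (hi ν hν)]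
    have h1 := hμ.le_integral M hM
    have h2 := hν.le_integral M hM
    linarith

/-- Orbit averages started at a maximizer of `Φ N` are almost optimal. -/
lemma IsSubadditiveRDS.exists_isAlmostOptimal [PolishSpace X] [BorelSpace X]
    (h : IsSubadditiveRDS ℙ θ φ K Φ) [IsProbabilityMeasure ℙ]
    {N : ℕ} (hN : N ≠ 0) (hl : N * lam ≤ ∫ ω, maxVal K (Φ N) ω ∂ℙ) :
    ∃ μ : Measure (Ω × X), IsAlmostOptimal ℙ θ φ K Φ lam N μ := by
  obtain ⟨y, hym, hyK, hy⟩ := h.isRandomCompact.exists_measurable_isMaxOn (h.isCaratheodory N)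
  have hgm : Measurable fun ω => (ω, y ω) := measurable_id.prodMk hym
  set ρ : Measure (Ω × X) := ℙ.map fun ω => (ω, y ω)
  have : IsProbabilityMeasure ρ := Measure.isProbabilityMeasure_map hgm.aemeasurable
  have hTm := h.measurable_skew
  have hfst : ∀ k, ρ.map (Prod.fst ∘ (skew θ φ)^[k]) = ℙ := fun k => by
    rw [Measure.map_map (measurable_fst.comp (hTm.iterate k)) hgm]
    have : (Prod.fst ∘ (skew θ φ)^[k]) ∘ (fun ω => (ω, y ω)) = θ^[k] := by
      funext ω
      simp [h.skew_iterate]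
    rw [this]
    exact (h.ergodic.toMeasurePreserving.iterate k).map_eq
  have hmem : ∀ k, ∀ᵐ p ∂(ρ.map (skew θ φ)^[k]), p.2 ∈ K p.1 := fun k => by
    have hG := h.isRandomCompact.measurableSet_graph
    rw [ae_map_iff (hTm.iterate k).aemeasurable hG]
    refine (ae_map_iff hgm.aemeasurable (hTm.iterate k hG)).2 ?_
    filter_upwards [h.ae_iterate_mem] with ω hω
    simpa [h.skew_iterate] using hω k (y ω) (hyK ω)
  have hΦm : ∀ i, Measurable fun p : Ω × X => Φ i p.1 p.2 := fun i =>
    (h.isCaratheodory i).measurable_uncurry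
  have hfst' : ∀ k, (ρ.map (skew θ φ)^[k]).map Prod.fst = ℙ := fun k => by
    rw [Measure.map_map measurable_fst (hTm.iterate k), hfst]
  let u : ℕ → Ω × X → ℝ := fun i p => Φ i p.1 p.2
  have hint : ∀ i k, Integrable (fun p => u i ((skew θ φ)^[k] p)) ρ := fun i k =>
    (integrable_map_measure (hΦm i).aestronglyMeasurable (hTm.iterate k).aemeasurable).1
      (integrable_of_marginal (hfst' k) (hmem k) (hΦm i) (h.integrable i)
        (abs_le_maxAbs h.isRandomCompact (h.isCaratheodory i)))
  have hbd : ∀ i k, |∫ p, u i ((skew θ φ)^[k] p) ∂ρ| ≤ ∫ ω, maxAbs K (Φ i) ω ∂ℙ := fun i k => by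
    have := abs_integral_le_of_marginal (hfst' k) (hmem k) (h.integrable i)
      (abs_le_maxAbs h.isRandomCompact (h.isCaratheodory i))
    rwa [integral_map (hTm.iterate k).aemeasurable (hΦm i).aestronglyMeasurable] at this
  refine ⟨orbitAverage (skew θ φ) ρ N, map_orbitAverage hTm measurable_fst hN hfst,
    ae_orbitAverage hmem, fun c F _ hF hc => abs_integral_comp_sub_orbitAverage_le hTm hF hc,
    fun M hM => ?_⟩
  have hN0 : (0 : ℝ) < N := by positivity
  rw [integral_orbitAverage hTm (hΦm _) (hint (M + 1))]
  obtain ⟨n, rfl⟩ := Nat.exists_eq_add_of_le' hM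
  have hbirk : ∀ k, Integrable (fun p => birkhoffSum (skew θ φ) (u (M + 1)) k p) ρ := fun k =>
    integrable_finsetSum _ fun j _ => hint (M + 1) j
  have hpt : ∀ p, ((M : ℝ) + 1) * u (n + M) p + ∑ s ∈ Finset.range M,
        u (M + 1) ((skew θ φ)^[n + s] p) ≤ ∑ s ∈ Finset.range (M + 1), u s p +
      birkhoffSum (skew θ φ) (u (M + 1)) (n + M) p +
        ∑ s ∈ Finset.range (M + 1), u (M - s) ((skew θ φ)^[n + s] p) := fun p => by
    have h1 := mul_subadditive_le (T := skew θ φ) (u := u) h.subadditive_skew M n p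
    have h2 : birkhoffSum (skew θ φ) (u (M + 1)) (n + M) p =
        birkhoffSum (skew θ φ) (u (M + 1)) n p + ∑ s ∈ Finset.range M,
          u (M + 1) ((skew θ φ)^[n + s] p) := Finset.sum_range_add _ _ _
    linarith
  have hI1 : Integrable (fun p => ((M : ℝ) + 1) * u (n + M) p) ρ := (hint (n + M) 0).const_mul _
  have hI2 : Integrable (fun p => ∑ s ∈ Finset.range M, u (M + 1) ((skew θ φ)^[n + s] p)) ρ :=
    integrable_finsetSum _ fun j _ => hint _ _
  have hI3 : Integrable (fun p => ∑ s ∈ Finset.range (M + 1), u s p) ρ :=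
    integrable_finsetSum _ fun j _ => hint j 0
  have hI4 : Integrable (fun p => ∑ s ∈ Finset.range (M + 1),
      u (M - s) ((skew θ φ)^[n + s] p)) ρ := integrable_finsetSum _ fun j _ => hint _ _
  have hle := integral_mono (hI1.add hI2) ((hI3.add (hbirk (n + M))).add hI4) hpt
  rw [integral_add' hI1 hI2, integral_add' (hI3.add (hbirk (n + M))) hI4,
    integral_add' hI3 (hbirk (n + M)), integral_const_mul,
    integral_finsetSum _ fun j _ => hint _ _,
    integral_finsetSum (f := u) _ fun j _ => hint j 0, integral_finsetSum _ fun j _ => hint _ _] at hle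
  have hmax : ∫ p, u (n + M) p ∂ρ = ∫ ω, maxVal K (Φ (n + M)) ω ∂ℙ := by
    rw [integral_map hgm.aemeasurable (hΦm _).aestronglyMeasurable]
    refine integral_congr_ae (Eventually.of_forall fun ω => ?_)
    refine le_antisymm (le_maxVal h.isRandomCompact (h.isCaratheodory _) ω _ (hyK ω))
      (csSup_le ((h.isRandomCompact.nonempty ω).image _) ?_)
    rintro _ ⟨x, hx, rfl⟩
    exact hy ω x hx
  have hS1 : ∑ s ∈ Finset.range (M + 1), ∫ p, u s p ∂ρ ≤
      ∑ s ∈ Finset.range (M + 1), ∫ ω, maxAbs K (Φ s) ω ∂ℙ :=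
    Finset.sum_le_sum fun s _ => (abs_le.1 (hbd s 0)).2
  have hS2 : ∑ s ∈ Finset.range (M + 1), ∫ p, u (M - s) ((skew θ φ)^[n + s] p) ∂ρ ≤
      ∑ s ∈ Finset.range (M + 1), ∫ ω, maxAbs K (Φ (M - s)) ω ∂ℙ :=
    Finset.sum_le_sum fun s _ => (abs_le.1 (hbd _ _)).2
  have hS3 : -∑ s ∈ Finset.range M, ∫ p, u (M + 1) ((skew θ φ)^[n + s] p) ∂ρ ≤
      ∑ s ∈ Finset.range M, ∫ ω, maxAbs K (Φ (M + 1)) ω ∂ℙ := by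
    rw [← Finset.sum_neg_distrib]
    exact Finset.sum_le_sum fun s _ => neg_le.1 (abs_le.1 (hbd _ _)).1
  rw [hmax] at hle
  have hM1 := mul_le_mul_of_nonneg_left hl (by positivity : (0 : ℝ) ≤ M + 1)
  have hfin : (M + 1) * (((n + M : ℕ) : ℝ) * lam) - blockError ℙ K Φ M ≤
      ∫ p, birkhoffSum (skew θ φ) (u (M + 1)) (n + M) p ∂ρ := by
    rw [blockError]
    linarith
  rw [← div_eq_inv_mul, le_div_iff₀ hN0, sub_mul, inv_mul_cancel_right₀ hN0.ne']
  linarith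

end Optimal

section Limit

variable {Ω X : Type*} [MeasurableSpace Ω] [MetricSpace X] [MeasurableSpace X]
  {ℙ : Measure Ω} {θ : Ω → Ω} {φ : ℕ → Ω → X → X} {K : Ω → Set X} {Φ : ℕ → Ω → X → ℝ} {lam : ℝ}

/-- Measures on `Ω × X` are determined by integrals of products of indicators and bounded
continuous functions. -/
lemma measure_ext_of_integral_indicator [BorelSpace X] {μ ν : Measure (Ω × X)}
    [IsFiniteMeasure μ] [IsFiniteMeasure ν]
    (h : ∀ A : Set Ω, MeasurableSet A → ∀ g : BoundedContinuousFunction X ℝ,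
      ∫ p, (A.indicator 1 p.1 : ℝ) * g p.2 ∂μ = ∫ p, (A.indicator 1 p.1 : ℝ) * g p.2 ∂ν) :
    μ = ν := by
  refine Measure.ext_prod fun {A B} hA hB => ?_
  have hrect : ∀ τ : Measure (Ω × X), ((τ.restrict (Prod.fst ⁻¹' A)).map Prod.snd) B = τ (A ×ˢ B) :=
    fun τ => by
      rw [Measure.map_apply measurable_snd hB, Measure.restrict_apply (measurable_snd hB),
        Set.inter_comm]
      rfl
  rw [← hrect μ, ← hrect ν]
  congr 1
  refine ext_of_forall_integral_eq_of_IsFiniteMeasure fun g => ?_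
  have hint : ∀ τ : Measure (Ω × X), ∫ x, g x ∂((τ.restrict (Prod.fst ⁻¹' A)).map Prod.snd) =
      ∫ p, (A.indicator 1 p.1 : ℝ) * g p.2 ∂τ := fun τ => by
    rw [integral_map measurable_snd.aemeasurable g.continuous.measurable.aestronglyMeasurable,
      ← integral_indicator (measurable_fst hA)]
    refine integral_congr_ae (Eventually.of_forall fun p => ?_)
    by_cases hp : p.1 ∈ A <;> simp [Set.indicator, hp]
  rw [hint, hint, h A hA g]

/-- Almost optimal measures have an optimal limit. -/
lemma IsSubadditiveRDS.exists_invariant [PolishSpace X] [BorelSpace X]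
    (h : IsSubadditiveRDS ℙ θ φ K Φ) [IsProbabilityMeasure ℙ]
    (hl : ∀ N : ℕ, N ≠ 0 → N * lam ≤ ∫ ω, maxVal K (Φ N) ω ∂ℙ) :
    ∃ μ : Measure (Ω × X), IsProbabilityMeasure μ ∧ μ.map (skew θ φ) = μ ∧ μ.map Prod.fst = ℙ ∧
      (∀ᵐ p ∂μ, p.2 ∈ K p.1) ∧ ∀ M : ℕ, (M + 1) * lam ≤ ∫ p, Φ (M + 1) p.1 p.2 ∂μ := by
  have hG := h.isRandomCompact.measurableSet_graph
  let S : ℕ → Set {κ : ProbabilityTheory.Kernel Ω X // ProbabilityTheory.IsMarkovKernel κ} :=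
    fun n => {κ | IsAlmostOptimal ℙ θ φ K Φ lam (n + 1) (ℙ.compProd κ.1)}
  have hM : ∀ κ : {κ : ProbabilityTheory.Kernel Ω X // ProbabilityTheory.IsMarkovKernel κ},
      ProbabilityTheory.IsMarkovKernel κ.1 := fun κ => κ.2
  have hsupp : ∀ n, ∀ κ ∈ S n, ∀ᵐ ω ∂ℙ, κ.1 ω (K ω)ᶜ = 0 := fun n κ hκ =>
    (ae_compProd_mem_iff hG).1 (IsAlmostOptimal.ae_mem hκ)
  obtain ⟨κs, κ, hκs, hκ, hlim⟩ := exists_kernel_limit ℙ h.isRandomCompact.isCompact (S := S)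
    (fun m n hmn κ hκ => IsAlmostOptimal.mono h m.succ_pos (by omega) hκ)
    (fun n => by
      obtain ⟨μ, hμ⟩ := h.exists_isAlmostOptimal n.succ_ne_zero (hl _ n.succ_ne_zero)
      have : IsProbabilityMeasure μ := by
        have := hμ.map_fst
        refine ⟨?_⟩
        rw [← Set.preimage_univ (f := (Prod.fst : Ω × X → Ω)),
          ← Measure.map_apply measurable_fst MeasurableSet.univ, this, measure_univ]
      obtain ⟨p⟩ : Nonempty (Ω × X) := nonempty_of_isProbabilityMeasure μ
      have : Nonempty X := ⟨p.2⟩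
      refine ⟨⟨μ.condKernel, inferInstance⟩, ?_⟩
      have hd := μ.disintegrate μ.condKernel
      rw [Measure.fst, hμ.map_fst] at hd
      change IsAlmostOptimal ℙ θ φ K Φ lam (n + 1) (ℙ.compProd μ.condKernel)
      rwa [hd])
    hsupp
    (fun n κ hκ η hη => by
      obtain ⟨ζ, hζM, hζ⟩ := exists_kernel_midpoint κ.1 η.1
      refine ⟨⟨ζ, hζM⟩, ?_, hζ⟩
      change IsAlmostOptimal ℙ θ φ K Φ lam (n + 1) (ℙ.compProd ζ)
      rw [compProd_half_add_half hζ]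
      exact IsAlmostOptimal.midpoint h hκ hη)
  have hconv : ∀ (f : Ω → X → ℝ) (b : Ω → ℝ), (Measurable fun p : Ω × X => f p.1 p.2) →
      (∀ ω, Continuous (f ω)) → Integrable b ℙ → (∀ ω, ∀ x ∈ K ω, |f ω x| ≤ b ω) →
      Tendsto (fun n => ∫ p, f p.1 p.2 ∂(ℙ.compProd (κs n).1)) atTop
        (nhds (∫ p, f p.1 p.2 ∂(ℙ.compProd κ.1))) := fun f b hf hfc hb hfb =>
    tendsto_integral_compProd (κs := fun n => (κs n).1) hG h.isRandomCompact.nonempty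
      (fun n => hsupp n _ (hκs n)) hκ hlim hf hfc hb hfb
  have hinv0 : Tendsto (fun n : ℕ => (((n + 1 : ℕ) : ℝ))⁻¹) atTop (nhds 0) := by
    simpa [one_div] using tendsto_one_div_add_atTop_nhds_zero_nat (𝕜 := ℝ)
  have hmap : (ℙ.compProd κ.1).map (skew θ φ) = ℙ.compProd κ.1 := by
    have := Measure.isProbabilityMeasure_map (μ := ℙ.compProd κ.1) h.measurable_skew.aemeasurable
    refine measure_ext_of_integral_indicator fun A hA g => ?_
    have hAm : Measurable (A.indicator (1 : Ω → ℝ)) := measurable_one.indicator hA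
    have hFm : Measurable fun p : Ω × X => (A.indicator 1 p.1 : ℝ) * g p.2 :=
      (hAm.comp measurable_fst).mul (g.continuous.measurable.comp measurable_snd)
    have hb : ∀ p : Ω × X, |(A.indicator 1 p.1 : ℝ) * g p.2| ≤ ‖g‖ := fun p => by
      by_cases hp : p.1 ∈ A
      · simpa [hp] using g.norm_coe_le_norm p.2
      · simp [hp]
    rw [integral_map h.measurable_skew.aemeasurable hFm.aestronglyMeasurable]
    have h1 := hconv (fun ω x => (A.indicator 1 ω : ℝ) * g x) (fun _ => ‖g‖) hFm
      (fun ω => by fun_prop) (integrable_const _) fun ω x _ => hb (ω, x)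
    have h2 := hconv (fun ω x => (A.indicator 1 (skew θ φ (ω, x)).1 : ℝ) * g (skew θ φ (ω, x)).2)
      (fun _ => ‖g‖) (hFm.comp h.measurable_skew)
      (fun ω => (continuous_const (y := (A.indicator 1 (θ ω) : ℝ))).mul
        (g.continuous.comp (h.continuous 1 ω)))
      (integrable_const _) fun ω x _ => hb _
    have h3 := (h2.sub h1).abs
    have h4 := hinv0.const_mul (2 * ‖g‖)
    rw [mul_zero] at h4
    exact sub_eq_zero.1 (abs_eq_zero.1 (le_antisymm (le_of_tendsto_of_tendsto h3 h4
      (Eventually.of_forall fun n =>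
        IsAlmostOptimal.abs_sub_le (hκs n) ‖g‖ _ (norm_nonneg _) hFm hb)) (abs_nonneg _)))
  refine ⟨ℙ.compProd κ.1, inferInstance, hmap, Measure.fst_compProd ℙ κ.1,
    (ae_compProd_mem_iff hG).2 hκ, fun M => ?_⟩
  have h1 := hconv (Φ (M + 1)) _ (h.isCaratheodory _).measurable_uncurry
    (h.isCaratheodory _).continuous (h.integrable (M + 1))
    (abs_le_maxAbs h.isRandomCompact (h.isCaratheodory _))
  have h2 := (tendsto_const_nhds (x := ((M : ℝ) + 1) * lam)).sub
    (hinv0.const_mul (blockError ℙ K Φ M))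
  rw [mul_zero, sub_zero] at h2
  refine le_of_tendsto_of_tendsto h2 h1 ?_
  filter_upwards [eventually_ge_atTop M] with n hn
  exact IsAlmostOptimal.le_integral (hκs n) M (by omega)

/-- If `λ(μ, φ) < lam` for all invariant measures on `K`, then the mean of the maximum of some
`Φ m` over `K` is smaller than `m * lam`. -/
lemma IsSubadditiveRDS.exists_integral_maxVal_lt [PolishSpace X] [BorelSpace X]
    (h : IsSubadditiveRDS ℙ θ φ K Φ) [IsProbabilityMeasure ℙ]
    (hlam : ∀ μ : Measure (Ω × X), IsProbabilityMeasure μ → μ.map (skew θ φ) = μ →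
      μ.map Prod.fst = ℙ → μ {p : Ω × X | p.2 ∈ K p.1} = 1 →
      ∀ l : ℝ, Tendsto (fun n : ℕ => (n : ℝ)⁻¹ * ∫ p, Φ n p.1 p.2 ∂μ) atTop (nhds l) → l < lam) :
    ∃ N : ℕ, N ≠ 0 ∧ ∫ ω, maxVal K (Φ N) ω ∂ℙ < N * lam := by
  by_contra! hcon
  obtain ⟨μ, hμP, hμinv, hμfst, hμK, hμ⟩ := h.exists_invariant hcon
  have hΦm : ∀ i, Measurable fun p : Ω × X => Φ i p.1 p.2 := fun i =>
    (h.isCaratheodory i).measurable_uncurry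
  have hΦi : ∀ i, Integrable (fun p : Ω × X => Φ i p.1 p.2) μ := fun i =>
    integrable_of_marginal hμfst hμK (hΦm i) (h.integrable i)
      (abs_le_maxAbs h.isRandomCompact (h.isCaratheodory i))
  have hmp : MeasurePreserving (skew θ φ) μ μ := ⟨h.measurable_skew, hμinv⟩
  have hsub : Subadditive fun n => ∫ p, Φ n p.1 p.2 ∂μ := fun n m => by
    have hmpm := hmp.iterate m
    have hi : Integrable (fun p => Φ n ((skew θ φ)^[m] p).1 ((skew θ φ)^[m] p).2) μ :=
      hmpm.integrable_comp_of_integrable (hΦi n)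
    have he : ∫ p, Φ n ((skew θ φ)^[m] p).1 ((skew θ φ)^[m] p).2 ∂μ = ∫ p, Φ n p.1 p.2 ∂μ := by
      conv_rhs => rw [← hmpm.map_eq]
      rw [integral_map hmpm.measurable.aemeasurable (hΦm n).aestronglyMeasurable]
    have := integral_mono (hΦi (n + m)) ((hΦi m).add hi) (h.subadditive_skew n m)
    rw [integral_add' (hΦi m) hi, he] at this
    linarith
  have hge : ∀ n : ℕ, n ≠ 0 → lam ≤ (∫ p, Φ n p.1 p.2 ∂μ) / n := fun n hn => by
    obtain ⟨M, rfl⟩ := Nat.exists_eq_succ_of_ne_zero hn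
    rw [le_div_iff₀ (by positivity), mul_comm]
    exact_mod_cast hμ M
  have hbdd : BddBelow (Set.range fun n : ℕ => (∫ p, Φ n p.1 p.2 ∂μ) / n) := by
    refine ⟨min 0 lam, ?_⟩
    rintro _ ⟨n, rfl⟩
    rcases eq_or_ne n 0 with rfl | hn
    · simp
    · exact (min_le_right _ _).trans (hge n hn)
  have hlim := hsub.tendsto_lim hbdd
  have hlt := hlam μ hμP hμinv hμfst
    ((prob_compl_eq_zero_iff h.isRandomCompact.measurableSet_graph).1 hμK) hsub.lim
    (by simpa only [div_eq_inv_mul] using hlim)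
  refine absurd (ge_of_tendsto hlim ?_) (not_le.2 hlt)
  filter_upwards [eventually_ne_atTop 0] with n hn using hge n hn

end Limit

section Bound

variable {Ω X : Type*} [MeasurableSpace Ω] [MetricSpace X] [MeasurableSpace X]
  {ℙ : Measure Ω} {θ : Ω → Ω} {φ : ℕ → Ω → X → X} {K : Ω → Set X} {Φ : ℕ → Ω → X → ℝ} {lam : ℝ}

/-- Pathwise block averaging on the random compact set. -/
lemma IsSubadditiveRDS.ae_mul_le (h : IsSubadditiveRDS ℙ θ φ K Φ) :
    ∀ᵐ ω ∂ℙ, ∀ M k : ℕ, ∀ x ∈ K ω, ((M : ℝ) + 1) * Φ (k + M) ω x ≤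
      ∑ s ∈ Finset.range (M + 1), maxAbs K (Φ s) ω + birkhoffSum θ (maxVal K (Φ (M + 1))) k ω +
        ∑ s ∈ Finset.range (M + 1), maxAbs K (Φ (M - s)) (θ^[s] (θ^[k] ω)) := by
  filter_upwards [h.ae_iterate_mem] with ω hω M k x hx
  have habs : ∀ i j, Φ i (θ^[j] ω) (φ j ω x) ≤ maxAbs K (Φ i) (θ^[j] ω) := fun i j =>
    (le_abs_self _).trans (abs_le_maxAbs h.isRandomCompact (h.isCaratheodory i) _ _ (hω j x hx))
  refine (mul_subadditive_le (T := skew θ φ) (u := fun i p => Φ i p.1 p.2)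
    h.subadditive_skew M k (ω, x)).trans (add_le_add (add_le_add ?_ ?_) ?_)
  · refine Finset.sum_le_sum fun s _ => ?_
    simpa [h.zero] using habs s 0
  · refine Finset.sum_le_sum fun j _ => ?_
    rw [h.skew_iterate]
    exact le_maxVal h.isRandomCompact (h.isCaratheodory _) _ _ (hω j x hx)
  · refine Finset.sum_le_sum fun s _ => ?_
    rw [h.skew_iterate, ← iterate_add_apply, add_comm s k]
    exact habs _ _

theorem IsSubadditiveRDS.exists_adjusted_bound [PolishSpace X] [BorelSpace X]
    (h : IsSubadditiveRDS ℙ θ φ K Φ) [IsProbabilityMeasure ℙ]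
    {N : ℕ} (hN : N ≠ 0) (hlt : ∫ ω, maxVal K (Φ N) ω ∂ℙ < N * lam) :
    ∃ C : Ω → ℝ, Measurable C ∧
      (∀ᵐ ω ∂ℙ, Tendsto (fun n : ℕ => C (θ^[n] ω) / n) atTop (nhds 0)) ∧
      ∀ᵐ ω ∂ℙ, ∀ n : ℕ, ∀ x ∈ K ω, Φ n ω x ≤ C ω + n * lam := by
  obtain ⟨M, rfl⟩ := Nat.exists_eq_succ_of_ne_zero hN
  have hαm : ∀ i, Measurable (maxAbs K (Φ i)) := fun i =>
    measurable_maxAbs h.isRandomCompact (h.isCaratheodory i)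
  have hα0 : ∀ i ω, 0 ≤ maxAbs K (Φ i) ω := fun i =>
    maxAbs_nonneg h.isRandomCompact (h.isCaratheodory i)
  have hαi : ∀ i, Integrable (maxAbs K (Φ i)) ℙ := h.integrable
  have hmp := h.ergodic.toMeasurePreserving
  set F : Ω → ℝ := fun ω => maxVal K (Φ (M + 1)) ω - (M + 1) * lam
  set b : Ω → ℝ := fun ω => ∑ s ∈ Finset.range (M + 1), maxAbs K (Φ s) ω
  set g : Ω → ℝ := fun ω => ∑ s ∈ Finset.range (M + 1), maxAbs K (Φ (M - s)) (θ^[s] ω)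
  have hbm : Measurable b := Finset.measurable_fun_sum _ fun s _ => hαm s
  have hbi : Integrable b ℙ := integrable_finsetSum _ fun s _ => hαi s
  have hgm : Measurable g := Finset.measurable_fun_sum _ fun s _ =>
    (hαm _).comp (hmp.measurable.iterate s)
  have hgi : Integrable g ℙ := integrable_finsetSum _ fun s _ =>
    (hmp.iterate s).integrable_comp_of_integrable (hαi _)
  have hFm : Measurable F :=
    (measurable_maxVal h.isRandomCompact (h.isCaratheodory _)).sub_const _
  have hFi : Integrable F ℙ := (h.integrable_maxVal _).sub (integrable_const _)
  have hFneg : ∫ ω, F ω ∂ℙ < 0 := by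
    have e : ∫ ω, F ω ∂ℙ = ∫ ω, maxVal K (Φ (M + 1)) ω ∂ℙ - (M + 1) * lam := by
      rw [integral_sub (h.integrable_maxVal _) (integrable_const _)]
      simp
    rw [e, sub_neg]
    exact_mod_cast hlt
  obtain ⟨D, hDm, hD0, hDlim, hD⟩ :=
    ae_birkhoffSum_add_sublinear h.ergodic hFm hFi hFneg hgm hgi
  refine ⟨fun ω => b ω + D ω + M * |lam|, (hbm.add hDm).add_const _, ?_, ?_⟩
  · filter_upwards [hDlim, ae_tendsto_iterate_div h.ergodic hbm hbi] with ω h1 h2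
    have h3 := tendsto_const_div_atTop_nhds_zero_nat (M * |lam|)
    simpa [add_div] using (h2.add h1).add h3
  · filter_upwards [hD, h.ae_mul_le] with ω hω hle n x hx
    have hb0 : 0 ≤ b ω := Finset.sum_nonneg fun s _ => hα0 s ω
    have hlam0 := neg_abs_le lam
    have hlam1 := abs_nonneg lam
    rcases lt_or_ge n M with hn | hn
    · have h1 : Φ n ω x ≤ b ω :=
        ((le_abs_self _).trans (abs_le_maxAbs h.isRandomCompact (h.isCaratheodory n) ω x hx)).trans
          (Finset.single_le_sum (f := fun s => maxAbs K (Φ s) ω) (fun s _ => hα0 s ω)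
            (Finset.mem_range.2 (by omega)))
      have h2 : (n : ℝ) * |lam| ≤ M * |lam| := by gcongr
      have h3 : (n : ℝ) * -|lam| ≤ n * lam := by gcongr
      have := hD0 ω
      linarith
    · obtain ⟨k, rfl⟩ := Nat.exists_eq_add_of_le' hn
      have h1 := hle M k x hx
      have h2 := hω k
      have h3 : birkhoffSum θ F k ω =
          birkhoffSum θ (maxVal K (Φ (M + 1))) k ω - k * ((M + 1) * lam) := by
        simp [F, birkhoffSum, Finset.sum_sub_distrib]
      have h4 : ((M : ℝ) + 1) * (Φ (k + M) ω x - k * lam) ≤ b ω + D ω := by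
        change _ ≤ b ω + _ + g (θ^[k] ω) at h1
        linarith
      have h5 : b ω + D ω ≤ ((M : ℝ) + 1) * (b ω + D ω) := by
        have := hD0 ω
        nlinarith [(Nat.cast_nonneg M : (0 : ℝ) ≤ M)]
      have h6 := le_of_mul_le_mul_left (h4.trans h5) (by positivity)
      have h7 : (M : ℝ) * -|lam| ≤ M * lam := by gcongr
      push_cast
      linarith

end Bound

end SemiuniformErgodic

open SemiuniformErgodic

/-- Random semiuniform ergodic theorem: Let `Θ(ω,x) = (θ ω, φ 1 ω x)`
be the skew product of a discrete-time RDS `φ` over an ergodic invertible `θ`,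
`K` a forward invariant random compact set, and `(Φ n)` a subadditive sequence of
random continuous functions with `ω ↦ max_{x ∈ K ω} |Φ n ω x|` integrable.
If `λ(μ,φ) < λ` for all `μ ∈ 𝓜_ℙ(K)`, then there exist `λ' < λ` and an adjusted
random variable `C : Ω → ℝ` with `Φ n ω x ≤ C ω + n λ'` for all `n`, ℙ-a.e. `ω`
and all `x ∈ K ω`; in particular for every `δ ∈ (0, λ − λ')` and ℙ-a.e. `ω` there
is `N ω` with `(1/n) Φ n ω x ≤ λ − δ` for `n ≥ N ω` and `x ∈ K ω`. -/
theorem random_semiuniform_ergodic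
    {Ω X : Type*} [MeasurableSpace Ω] [MetricSpace X] [PolishSpace X]
    [MeasurableSpace X] [BorelSpace X]
    (ℙ : Measure Ω) [IsProbabilityMeasure ℙ]
    (θ : Ω → Ω) (hθerg : Ergodic θ ℙ) (hθbij : Function.Bijective θ)
    (φ : ℕ → Ω → X → X)
    (hφmeas : Measurable fun p : ℕ × Ω × X => φ p.1 p.2.1 p.2.2)
    (hφ0 : ∀ ω, φ 0 ω = id)
    (hcocycle : ∀ (n m : ℕ) (ω : Ω), φ (n + m) ω = (φ n (θ^[m] ω)) ∘ (φ m ω))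
    (hφcont : ∀ n ω, Continuous (φ n ω))
    (K : Ω → Set X)
    (hKcpt : ∀ ω, IsCompact (K ω)) (hKne : ∀ ω, (K ω).Nonempty)
    (hKmeas : ∀ x : X, Measurable fun ω => infDist x (K ω))
    (hKinv : ∀ᵐ ω ∂ℙ, φ 1 ω '' K ω ⊆ K (θ ω))
    (Φ : ℕ → Ω → X → ℝ)
    (hΦmeas : ∀ n x, Measurable fun ω => Φ n ω x)
    (hΦcont : ∀ n ω, Continuous (Φ n ω))
    (hsub : ∀ (n m : ℕ) (ω : Ω) (x : X),
      Φ (n + m) ω x ≤ Φ m ω x + Φ n (θ^[m] ω) (φ m ω x))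
    (hint : ∀ n : ℕ, Integrable (fun ω => sSup ((fun x => |Φ n ω x|) '' K ω)) ℙ)
    (lam : ℝ)
    (hlam : ∀ μ : Measure (Ω × X), IsProbabilityMeasure μ →
      μ.map (fun p : Ω × X => (θ p.1, φ 1 p.1 p.2)) = μ →
      μ.map Prod.fst = ℙ →
      μ {p : Ω × X | p.2 ∈ K p.1} = 1 →
      ∀ l : ℝ, Tendsto (fun n : ℕ => (n : ℝ)⁻¹ * ∫ p, Φ n p.1 p.2 ∂μ)
        atTop (nhds l) → l < lam) :
    ∃ lam' : ℝ, lam' < lam ∧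
      ∃ C : Ω → ℝ, Measurable C ∧
        -- `C` is adjusted to `θ`
        (∀ᵐ ω ∂ℙ, Tendsto (fun n : ℕ => C (θ^[n] ω) / n) atTop (nhds 0)) ∧
        (∀ᵐ ω ∂ℙ, ∀ n : ℕ, ∀ x ∈ K ω, Φ n ω x ≤ C ω + n * lam') ∧
        -- in particular:
        (∀ δ : ℝ, 0 < δ → δ < lam - lam' →
          ∀ᵐ ω ∂ℙ, ∃ N : ℕ, ∀ n : ℕ, N ≤ n → ∀ x ∈ K ω,
            (n : ℝ)⁻¹ * Φ n ω x ≤ lam - δ) := by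
  have h : IsSubadditiveRDS ℙ θ φ K Φ :=
    ⟨hθerg, hφmeas, hφ0, hcocycle, hφcont, ⟨hKcpt, hKne, hKmeas⟩, hKinv,
      fun n => ⟨hΦmeas n, hΦcont n⟩, hsub, hint⟩
  obtain ⟨N, hN, hNlt⟩ := h.exists_integral_maxVal_lt hlam
  have hN0 : (0 : ℝ) < N := by positivity
  obtain ⟨lam', h1, h2⟩ := exists_between ((div_lt_iff₀' hN0).2 hNlt)
  obtain ⟨C, hCm, hCadj, hC⟩ := h.exists_adjusted_bound hN ((div_lt_iff₀' hN0).1 h1)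
  refine ⟨lam', h2, C, hCm, hCadj, hC, fun δ _ hδ => ?_⟩
  filter_upwards [hC] with ω hω
  have hlim := (tendsto_const_div_atTop_nhds_zero_nat (C ω)).eventually_lt_const
    (show (0 : ℝ) < lam - δ - lam' by linarith)
  obtain ⟨n₀, hn₀⟩ := eventually_atTop.1 (hlim.and (eventually_gt_atTop 0))
  refine ⟨n₀, fun n hn x hx => ?_⟩
  obtain ⟨h3, h4⟩ := hn₀ n hn
  have h5 : (0 : ℝ) < n := by exact_mod_cast h4
  rw [← div_eq_inv_mul]
  calc Φ n ω x / n ≤ (C ω + n * lam') / n := by gcongr; exact hω n x hx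
    _ = C ω / n + lam' := by field_simp
    _ ≤ lam - δ := by linarith
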